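/- arXiv:2502.10791 — 2 statements merged into one kernel-verified Lean document; each statement's English description precedes it below -/
import Mathlib

section
/- Let k̄ be even with 4 ≤ k̄ ≤ L/2 and let Q = Σ_{A∈P_Λ, Diag A ≤ k̄} q_A A satisfy [H,Q] = 0. Then q_{C^{k̄}_j} = 0 for every base site u_1 and every j; consequently, q_A = 0 for every Pauli product A with Diag A = k̄, and there is no local conserved quantity of H with diagonal length k̄. -/
open Complex Matrix

/-- Sites of the `L × L` square lattice with periodic boundary conditions. -/
abbrev Site (L : ℕ) := ZMod L × ZMod L

/-- A specification of a product of Pauli matrices: at each site either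
`0` (no operator), `1` (`X`), `2` (`Y`) or `3` (`Z`). -/
abbrev PSpec (L : ℕ) := Site L → Fin 4

/-- Operators on the Hilbert space `⊗_{u ∈ Λ} ℂ²`. -/
abbrev Op (L : ℕ) := Matrix (Site L → Fin 2) (Site L → Fin 2) ℂ

/-- The Pauli matrices (`0` gives the identity). -/
noncomputable def pauli (w : Fin 4) : Matrix (Fin 2) (Fin 2) ℂ :=
  if w = 1 then !![0, 1; 1, 0]
  else if w = 2 then !![0, -Complex.I; Complex.I, 0]
  else if w = 3 then !![1, 0; 0, -1]
  else 1

/-- The product of Pauli matrices specified by `σ`, as an operator (matrix)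
on the full Hilbert space. -/
noncomputable def PauliOp (L : ℕ) [NeZero L] (σ : PSpec L) : Op L :=
  fun s t => ∏ u : Site L, pauli (σ u) (s u) (t u)

/-- `DiagBoundAt L σ a k` : every site `u` in the support of `σ` satisfies
`0 ≤ uₓ + u_y − a ≤ k − 1 (mod L)`. -/
def DiagBoundAt (L : ℕ) (σ : PSpec L) (a : ZMod L) (k : ℕ) : Prop :=
  ∀ u : Site L, σ u ≠ 0 → (u.1 + u.2 - a).val < k

/-- The diagonal length of a Pauli product. -/
noncomputable def Diag (L : ℕ) (σ : PSpec L) : ℕ :=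
  sInf {k | ∃ a : ZMod L, DiagBoundAt L σ a k}

/-- `X_u` as a Pauli-product specification. -/
def sigX (L : ℕ) (u : Site L) : PSpec L := fun v => if v = u then 1 else 0
/-- `Y_u` as a Pauli-product specification. -/
def sigY (L : ℕ) (u : Site L) : PSpec L := fun v => if v = u then 2 else 0
/-- `Z_u` as a Pauli-product specification. -/
def sigZ (L : ℕ) (u : Site L) : PSpec L := fun v => if v = u then 3 else 0
/-- A single-site Pauli operator `W_u` (`w ∈ {1,2,3}`). -/
def sigW (L : ℕ) (u : Site L) (w : Fin 4) : PSpec L := fun v => if v = u then w else 0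

/-- `X_u X_{u+eₓ}` as a Pauli-product specification. -/
def sigXX (L : ℕ) (u : Site L) : PSpec L :=
  fun v => if v = u then 1 else if v = u + (1, 0) then 1 else 0
/-- `Y_u Y_{u+e_y}` as a Pauli-product specification. -/
def sigYY (L : ℕ) (u : Site L) : PSpec L :=
  fun v => if v = u then 2 else if v = u + (0, 1) then 2 else 0

/-- The quantum compass Hamiltonian
`H = −Σ_u (Jx X_u X_{u+eₓ} + Jy Y_u Y_{u+e_y})`. -/
noncomputable def Hcompass (L : ℕ) [NeZero L] (Jx Jy : ℝ) : Op L :=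
  - ∑ u : Site L, ((Jx : ℂ) • PauliOp L (sigXX L u) + (Jy : ℂ) • PauliOp L (sigYY L u))

/-- The quantum compass Hamiltonian with a uniform magnetic field. -/
noncomputable def Hfield (L : ℕ) [NeZero L] (Jx Jy hx hy hz : ℝ) : Op L :=
  - ∑ u : Site L,
      ((Jx : ℂ) • PauliOp L (sigXX L u) + (Jy : ℂ) • PauliOp L (sigYY L u)
        + (hx : ℂ) • PauliOp L (sigX L u) + (hy : ℂ) • PauliOp L (sigY L u)
        + (hz : ℂ) • PauliOp L (sigZ L u))

/-- The candidate conserved quantity `Q = Σ_σ q_σ σ`. -/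
noncomputable def Qop (L : ℕ) [NeZero L] (q : PSpec L → ℂ) : Op L :=
  ∑ σ : PSpec L, q σ • PauliOp L σ

/-- Commutator of operators. -/
noncomputable def opComm (L : ℕ) [NeZero L] (A B : Op L) : Op L := A * B - B * A

/-- The coefficient `λ_{σ,τ}` of the Pauli product `τ` in the expansion
`[H, σ] = Σ_τ λ_{σ,τ} τ`, extracted via the (normalized) trace inner product. -/
noncomputable def lam (L : ℕ) [NeZero L] (H : Op L) (σ τ : PSpec L) : ℂ :=
  Matrix.trace (PauliOp L τ * opComm L H (PauliOp L σ)) / (2 ^ Fintype.card (Site L))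

/-- `u` is a top-right site of `σ` (relative to the witness `a` for diagonal
length `k`). -/
def IsTopRight (L : ℕ) (σ : PSpec L) (a : ZMod L) (k : ℕ) (u : Site L) : Prop :=
  σ u ≠ 0 ∧ (u.1 + u.2 - a).val = k - 1

/-- `u` is a bottom-left site of `σ` (relative to the witness `a`). -/
def IsBottomLeft (L : ℕ) (σ : PSpec L) (a : ZMod L) (u : Site L) : Prop :=
  σ u ≠ 0 ∧ (u.1 + u.2 - a).val = 0

/-- Condition (1): `σ` has a unique top-right site `ū`, with
(1a) `σ_ū = X` and `ū − eₓ ∈ Supp σ`, or (1b) `σ_ū = Y` and `ū − e_y ∈ Supp σ`. -/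
def Cond1 (L : ℕ) (σ : PSpec L) (a : ZMod L) (k : ℕ) : Prop :=
  ∃ ub : Site L, (∀ v : Site L, IsTopRight L σ a k v ↔ v = ub) ∧
    ((σ ub = 1 ∧ σ (ub - (1, 0)) ≠ 0) ∨ (σ ub = 2 ∧ σ (ub - (0, 1)) ≠ 0))

/-- Condition (2): `σ` has a unique bottom-left site `u̲`, with
(2a) `σ_u̲ = X` and `u̲ + eₓ ∈ Supp σ`, or (2b) `σ_u̲ = Y` and `u̲ + e_y ∈ Supp σ`. -/
def Cond2 (L : ℕ) (σ : PSpec L) (a : ZMod L) : Prop :=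
  ∃ lb : Site L, (∀ v : Site L, IsBottomLeft L σ a v ↔ v = lb) ∧
    ((σ lb = 1 ∧ σ (lb + (1, 0)) ≠ 0) ∨ (σ lb = 2 ∧ σ (lb + (0, 1)) ≠ 0))

/-- `ShiftRel L k σ σ'` : `σ` has diagonal length `k`, satisfies conditions (1)
and (2), and `σ'` is the Shiraishi shift `S(σ)`, obtained by first appending a
site at the top right (the product `B`) and then truncating the bottom-left site. -/
def ShiftRel (L : ℕ) [NeZero L] (k : ℕ) (σ σ' : PSpec L) : Prop :=
  Diag L σ = k ∧ σ' ≠ 0 ∧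
  ∃ a : ZMod L, DiagBoundAt L σ a k ∧
  ∃ ub lb : Site L,
    (∀ v : Site L, IsTopRight L σ a k v ↔ v = ub) ∧
    (∀ v : Site L, IsBottomLeft L σ a v ↔ v = lb) ∧
    ∃ B : Op L,
      ((σ ub = 1 ∧ σ (ub - (1, 0)) ≠ 0 ∧
          B = (-(1 / (2 * Complex.I))) • opComm L (PauliOp L (sigYY L ub)) (PauliOp L σ)) ∨
       (σ ub = 2 ∧ σ (ub - (0, 1)) ≠ 0 ∧
          B = (1 / (2 * Complex.I)) • opComm L (PauliOp L (sigXX L ub)) (PauliOp L σ))) ∧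
      ∃ ε : ℂ, (ε = 1 / (2 * Complex.I) ∨ ε = -(1 / (2 * Complex.I))) ∧
        ((σ lb = 1 ∧ σ (lb + (1, 0)) ≠ 0 ∧
            PauliOp L σ' = ε • opComm L (PauliOp L (sigXX L lb)) B) ∨
         (σ lb = 2 ∧ σ (lb + (0, 1)) ≠ 0 ∧
            PauliOp L σ' = ε • opComm L (PauliOp L (sigYY L lb)) B))

/-- The staircase sequence `u_j`: `u_j = u₁ + ((j−1)/2)(eₓ+e_y)` for odd `j`,
and `u_j = u₁ + (j/2)(eₓ+e_y) − e_y` for even `j`. -/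
def stair (L : ℕ) (u1 : Site L) (j : ℕ) : Site L :=
  if j % 2 = 1 then
    u1 + ((((j - 1) / 2 : ℕ) : ZMod L), (((j - 1) / 2 : ℕ) : ZMod L))
  else
    u1 + (((j / 2 : ℕ) : ZMod L), ((j / 2 : ℕ) : ZMod L)) - ((0 : ZMod L), (1 : ZMod L))

/-- The Pauli letter at the first (bottom-left) end of `C^k_j`. -/
def endL (j : ℕ) : Fin 4 := if j % 2 = 1 then 1 else 2

/-- The Pauli letter at the last (top-right) end of `C^k_j`. -/
def endR (k j : ℕ) : Fin 4 :=
  if k % 2 = 1 then (if j % 2 = 1 then 2 else 1)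
  else (if j % 2 = 1 then 1 else 2)

/-- The standard-form product `C^k_j` based at `u₁`: the appropriate end
letters at `u_j` and `u_{j+k−1}`, and `Z` at `u_{j+1}, …, u_{j+k−2}`. -/
def Cspec (L : ℕ) (k j : ℕ) (u1 : Site L) : PSpec L := fun v =>
  if v = stair L u1 j then endL j
  else if v = stair L u1 (j + k - 1) then endR k j
  else if v ∈ (Finset.Icc (j + 1) (j + k - 2)).image (stair L u1) then 3
  else 0

/-- The letter of the product of two Pauli matrices, up to a phase. -/
def letterMul (a b : Fin 4) : Fin 4 :=
  ![![0, 1, 2, 3], ![1, 0, 3, 2], ![2, 3, 0, 1], ![3, 2, 1, 0]] a b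

/-- The phase in the product of two Pauli matrices. -/
noncomputable def letterPhase (a b : Fin 4) : ℂ :=
  ![![1, 1, 1, 1], ![1, 1, I, -I], ![1, -I, 1, I], ![1, I, -I, 1]] a b

/-- The product of two Pauli products, up to a phase. -/
def specMul {L : ℕ} (σ τ : PSpec L) : PSpec L := fun v => letterMul (σ v) (τ v)

/-- The letter of the bonds in a given direction: `X` for `false`, `Y` for `true`. -/
def bondLetter (t : Bool) : Fin 4 := if t then 2 else 1

/-- The lattice vector of the bonds in a given direction. -/
def bondDir (L : ℕ) (t : Bool) : Site L := if t then (0, 1) else (1, 0)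

/-- The interaction term of the bond starting at `b.1` in direction `b.2`. -/
def bondSpec {L : ℕ} (b : Site L × Bool) : PSpec L := fun v =>
  if v = b.1 then bondLetter b.2
  else if v = b.1 + bondDir L b.2 then bondLetter b.2 else 0

/-- The bond term anticommutes with the Pauli product. -/
def BondAnti {L : ℕ} (b : Site L × Bool) (τ : PSpec L) : Prop :=
  ¬ ((τ b.1 ≠ 0 ∧ τ b.1 ≠ bondLetter b.2) ↔
    (τ (b.1 + bondDir L b.2) ≠ 0 ∧ τ (b.1 + bondDir L b.2) ≠ bondLetter b.2))

lemma letterMul_comm (a b : Fin 4) : letterMul a b = letterMul b a := by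
  revert a b; decide

lemma letterMul_left_comm (a b c : Fin 4) :
    letterMul a (letterMul b c) = letterMul b (letterMul a c) := by
  revert a b c; decide

lemma letterMul_cancel (a b : Fin 4) : letterMul a (letterMul a b) = b := by
  revert a b; decide

@[simp] lemma letterMul_zero (a : Fin 4) : letterMul a 0 = a := by
  revert a; decide

@[simp] lemma zero_letterMul (a : Fin 4) : letterMul 0 a = a := by
  revert a; decide

lemma letterMul_eq_zero {a b : Fin 4} : letterMul a b = 0 ↔ a = b := by
  revert a b; decide

lemma bondLetter_ne_zero (t : Bool) : bondLetter t ≠ 0 := by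
  revert t; decide

lemma bondLetter_inj {t t' : Bool} : bondLetter t = bondLetter t' ↔ t = t' := by
  revert t t'; decide

lemma specMul_left_comm {L : ℕ} (a b c : PSpec L) :
    specMul a (specMul b c) = specMul b (specMul a c) :=
  funext fun _ => letterMul_left_comm _ _ _

lemma specMul_cancel {L : ℕ} (a b : PSpec L) : specMul a (specMul a b) = b :=
  funext fun _ => letterMul_cancel _ _

lemma pauli_mul (a b : Fin 4) :
    pauli a * pauli b = letterPhase a b • pauli (letterMul a b) := by
  fin_cases a <;> fin_cases b <;>
    ext i j <;> fin_cases i <;> fin_cases j <;>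
    simp [pauli, letterPhase, letterMul, Matrix.mul_apply, Fin.sum_univ_two]

lemma trace_pauli_mul (a b : Fin 4) :
    ∑ s, (pauli a * pauli b) s s = if a = b then 2 else 0 := by
  fin_cases a <;> fin_cases b <;>
    simp [pauli, Matrix.mul_apply, Fin.sum_univ_two] <;> norm_num

lemma bondDir_ne_zero {L : ℕ} (hL : 1 < L) (t : Bool) : bondDir L t ≠ 0 := by
  have : Fact (1 < L) := ⟨hL⟩
  cases t <;> simp [bondDir, Prod.ext_iff]

section Operators

variable {L : ℕ} [NeZero L]

lemma PauliOp_mul_apply (σ τ : PSpec L) (s t : Site L → Fin 2) :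
    (PauliOp L σ * PauliOp L τ) s t = ∏ u, (pauli (σ u) * pauli (τ u)) (s u) (t u) := by
  simp only [Matrix.mul_apply, PauliOp, ← Finset.prod_mul_distrib]
  exact (Fintype.prod_sum fun u x => pauli (σ u) (s u) x * pauli (τ u) x (t u)).symm

lemma PauliOp_mul (σ τ : PSpec L) :
    PauliOp L σ * PauliOp L τ =
      (∏ u, letterPhase (σ u) (τ u)) • PauliOp L (specMul σ τ) := by
  ext s t
  simp [PauliOp_mul_apply, pauli_mul, PauliOp, specMul, Finset.prod_mul_distrib]

lemma trace_PauliOp_mul (σ τ : PSpec L) :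
    Matrix.trace (PauliOp L σ * PauliOp L τ) =
      if σ = τ then 2 ^ Fintype.card (Site L) else 0 := by
  simp only [Matrix.trace, Matrix.diag, PauliOp_mul_apply]
  rw [← Fintype.prod_sum fun u x => (pauli (σ u) * pauli (τ u)) x x]
  simp only [trace_pauli_mul]
  split_ifs with h
  · simp [h]
  · obtain ⟨u, hu⟩ := Function.ne_iff.mp h
    exact Finset.prod_eq_zero (Finset.mem_univ u) (if_neg hu)

lemma coeff_eq_zero_of_sum_eq_zero (c : PSpec L → ℂ)
    (h : ∑ σ, c σ • PauliOp L σ = 0) (τ : PSpec L) : c τ = 0 := by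
  have h1 : Matrix.trace (PauliOp L τ * ∑ σ, c σ • PauliOp L σ) = 0 := by simp [h]
  simpa [Finset.mul_sum, Matrix.trace_sum, trace_PauliOp_mul] using h1

/-- The structure constant of the commutator of a bond term with a Pauli product,
divided by `2i`. -/
noncomputable def bondSign (b : Site L × Bool) (τ : PSpec L) : ℂ :=
  (∏ u, letterPhase (bondSpec b u) (specMul (bondSpec b) τ u) -
    ∏ u, letterPhase (specMul (bondSpec b) τ u) (bondSpec b u)) / (2 * I)

lemma bondSign_eq (hL : 1 < L) (b : Site L × Bool) (τ : PSpec L) :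
    bondSign b τ =
      (letterPhase (bondLetter b.2) (letterMul (bondLetter b.2) (τ b.1)) *
        letterPhase (bondLetter b.2)
          (letterMul (bondLetter b.2) (τ (b.1 + bondDir L b.2))) -
       letterPhase (letterMul (bondLetter b.2) (τ b.1)) (bondLetter b.2) *
        letterPhase (letterMul (bondLetter b.2) (τ (b.1 + bondDir L b.2)))
          (bondLetter b.2)) / (2 * I) := by
  have hne : b.1 ≠ b.1 + bondDir L b.2 := by simpa using bondDir_ne_zero hL b.2
  have h0 : ∀ a, letterPhase 0 a = 1 := by
    intro a; fin_cases a <;> simp [letterPhase]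
  have h0' : ∀ a, letterPhase a 0 = 1 := by
    intro a; fin_cases a <;> simp [letterPhase]
  unfold bondSign
  rw [Fintype.prod_eq_mul b.1 _ hne (fun x hx => by simp [bondSpec, hx.1, hx.2, h0]),
    Fintype.prod_eq_mul b.1 _ hne (fun x hx => by simp [bondSpec, hx.1, hx.2, h0'])]
  simp [bondSpec, specMul]

lemma bondSign_of_not_anti (hL : 1 < L) {b : Site L × Bool} {τ : PSpec L}
    (h : ¬ BondAnti b τ) : bondSign b τ = 0 := by
  rw [bondSign_eq hL]
  rw [BondAnti, not_not] at h
  revert h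
  generalize τ b.1 = x
  generalize τ (b.1 + bondDir L b.2) = y
  generalize b.2 = t
  cases t <;> fin_cases x <;> fin_cases y <;>
    simp [bondLetter, letterMul, letterPhase]

lemma bondSign_of_anti (hL : 1 < L) {b : Site L × Bool} {τ : PSpec L}
    (h : BondAnti b τ) : bondSign b τ = 1 ∨ bondSign b τ = -1 := by
  rw [bondSign_eq hL]
  rw [BondAnti] at h
  revert h
  have h1 : (I + I) / (2 * I) = 1 := by
    rw [← two_mul]; exact div_self (by simp)
  have h2 : (-I - I) / (2 * I) = -1 := by
    rw [← neg_add', neg_div, h1]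
  generalize τ b.1 = x
  generalize τ (b.1 + bondDir L b.2) = y
  generalize b.2 = t
  cases t <;> fin_cases x <;> fin_cases y <;>
    simp [bondLetter, letterMul, letterPhase, h1, h2]

/-- The coupling constant of the bonds in a given direction. -/
noncomputable def coupling (Jx Jy : ℝ) (t : Bool) : ℂ := if t then (Jy : ℂ) else (Jx : ℂ)

lemma Hcompass_eq (Jx Jy : ℝ) :
    Hcompass L Jx Jy =
      -∑ b : Site L × Bool, coupling Jx Jy b.2 • PauliOp L (bondSpec b) := by
  rw [Fintype.sum_prod_type, Hcompass]
  congr 1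
  refine Finset.sum_congr rfl fun u _ => ?_
  rw [Fintype.sum_bool, add_comm]
  rfl

/-- The coefficient of each Pauli product in `[H, Q] = 0` vanishes. -/
lemma sum_bondSign_eq_zero {Jx Jy : ℝ} {q : PSpec L → ℂ}
    (hcons : opComm L (Hcompass L Jx Jy) (Qop L q) = 0) (τ : PSpec L) :
    ∑ b : Site L × Bool,
      coupling Jx Jy b.2 * bondSign b τ * q (specMul (bondSpec b) τ) = 0 := by
  have key : ∑ σ : PSpec L, (∑ b : Site L × Bool,
      coupling Jx Jy b.2 * (bondSign b σ * (2 * I)) * q (specMul (bondSpec b) σ)) •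
        PauliOp L σ = 0 := by
    rw [Hcompass_eq, Qop, opComm, neg_mul, mul_neg, sub_neg_eq_add, neg_add_eq_zero] at hcons
    simp only [Finset.sum_smul]
    rw [Finset.sum_comm]
    have h1 : ∀ b : Site L × Bool,
        ∑ σ : PSpec L, (coupling Jx Jy b.2 * (bondSign b σ * (2 * I)) *
          q (specMul (bondSpec b) σ)) • PauliOp L σ =
        ∑ σ : PSpec L, ((coupling Jx Jy b.2 • PauliOp L (bondSpec b)) *
          (q σ • PauliOp L σ) -
          (q σ • PauliOp L σ) * (coupling Jx Jy b.2 • PauliOp L (bondSpec b))) := by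
      intro b
      have hinv : Function.Involutive (specMul (bondSpec b)) := specMul_cancel _
      rw [← Equiv.sum_comp (hinv.toPerm _)]
      refine Finset.sum_congr rfl fun σ _ => ?_
      have h2 : (2 * I : ℂ) ≠ 0 := by simp
      have h3 : specMul σ (bondSpec b) = specMul (bondSpec b) σ :=
        funext fun _ => letterMul_comm _ _
      simp only [Function.Involutive.coe_toPerm, bondSign, div_mul_cancel₀ _ h2,
        specMul_cancel, smul_mul_smul_comm, PauliOp_mul, h3, smul_smul, ← sub_smul]
      congr 1
      ring
    rw [Finset.sum_congr rfl fun b _ => h1 b]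
    simp only [Finset.sum_sub_distrib]
    rw [sub_eq_zero]
    simp only [← Finset.mul_sum, ← Finset.sum_mul]
    exact hcons
  have h := coeff_eq_zero_of_sum_eq_zero _ key τ
  have h2 : (2 * I : ℂ) ≠ 0 := by simp
  refine (mul_eq_zero.mp ?_).resolve_right h2
  rw [← h, Finset.sum_mul]
  exact Finset.sum_congr rfl fun b _ => by ring

end Operators

section Bonds

variable {L : ℕ}

lemma bondDir_sum (t : Bool) : (bondDir L t).1 + (bondDir L t).2 = 1 := by
  cases t <;> simp [bondDir]

lemma specMul_bondSpec_of_ne {b : Site L × Bool} {τ : PSpec L} {v : Site L}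
    (h1 : v ≠ b.1) (h2 : v ≠ b.1 + bondDir L b.2) : specMul (bondSpec b) τ v = τ v := by
  simp [specMul, bondSpec, h1, h2]

lemma specMul_bondSpec_left (b : Site L × Bool) (τ : PSpec L) :
    specMul (bondSpec b) τ b.1 = letterMul (bondLetter b.2) (τ b.1) := by
  simp [specMul, bondSpec]

lemma specMul_bondSpec_right (b : Site L × Bool) (τ : PSpec L) :
    specMul (bondSpec b) τ (b.1 + bondDir L b.2) =
      letterMul (bondLetter b.2) (τ (b.1 + bondDir L b.2)) := by
  simp only [specMul, bondSpec]
  split_ifs <;> simp_all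

/-- A bond term can only delete a site at one of its end points carrying its own letter. -/
lemma eq_of_specMul_bondSpec_eq_zero {b : Site L × Bool} {τ : PSpec L} {v : Site L}
    (h : specMul (bondSpec b) τ v = 0) (hv : τ v ≠ 0) :
    (v = b.1 ∨ v = b.1 + bondDir L b.2) ∧ τ v = bondLetter b.2 := by
  rw [specMul, letterMul_eq_zero, bondSpec] at h
  split_ifs at h with h1 h2
  · exact ⟨Or.inl h1, h.symm⟩
  · exact ⟨Or.inr h2, h.symm⟩
  · exact absurd h.symm hv

lemma bondAnti_specMul_iff (b : Site L × Bool) (τ : PSpec L) :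
    BondAnti b (specMul (bondSpec b) τ) ↔ BondAnti b τ := by
  have h : ∀ (t : Bool) (c : Fin 4), (letterMul (bondLetter t) c ≠ 0 ∧
      letterMul (bondLetter t) c ≠ bondLetter t) ↔ (c ≠ 0 ∧ c ≠ bondLetter t) := by decide
  rw [BondAnti, specMul_bondSpec_left, specMul_bondSpec_right, h, h, BondAnti]

lemma bondAnti_of_left {b : Site L × Bool} {τ : PSpec L} (h0 : τ b.1 ≠ 0)
    (h1 : τ b.1 ≠ bondLetter b.2)
    (h2 : τ (b.1 + bondDir L b.2) = 0 ∨ τ (b.1 + bondDir L b.2) = bondLetter b.2) :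
    BondAnti b τ := by
  unfold BondAnti
  tauto

lemma bondAnti_of_right {b : Site L × Bool} {τ : PSpec L}
    (h0 : τ (b.1 + bondDir L b.2) ≠ 0) (h1 : τ (b.1 + bondDir L b.2) ≠ bondLetter b.2)
    (h2 : τ b.1 = 0 ∨ τ b.1 = bondLetter b.2) : BondAnti b τ := by
  unfold BondAnti
  tauto

lemma bondDir_injective (hL : 1 < L) {t t' : Bool} (h : bondDir L t = bondDir L t') :
    t = t' := by
  have : Fact (1 < L) := ⟨hL⟩
  cases t <;> cases t' <;> simp_all [bondDir]

lemma three_ne_bondLetter (t : Bool) : (3 : Fin 4) ≠ bondLetter t := by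
  revert t
  decide

lemma letterMul_bondLetter_three (r : Bool) :
    letterMul (bondLetter (!r)) 3 = bondLetter r := by
  revert r
  decide

lemma letterMul_bondLetter_not (r : Bool) :
    letterMul (bondLetter (!r)) (bondLetter r) = 3 := by
  revert r
  decide

/-- The letter in position `i` of the alternating sequence of directions starting with `r`. -/
def altDir (r : Bool) (i : ℕ) : Bool := if i % 2 = 0 then r else !r

lemma altDir_succ_ne (r : Bool) (i : ℕ) : altDir r (i + 1) = !altDir r i := by
  rcases Nat.mod_two_eq_zero_or_one i with h | h <;> simp [altDir, Nat.add_mod, h]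

lemma altDir_not (r : Bool) (i : ℕ) : altDir (!r) i = altDir r (i + 1) := by
  rcases Nat.mod_two_eq_zero_or_one i with h | h <;> simp [altDir, Nat.add_mod, h]

/-- The staircase path starting at `w` with a step in direction `r`. -/
def path (w : Site L) (r : Bool) : ℕ → Site L
  | 0 => w
  | i + 1 => path w r i + bondDir L (altDir r i)

lemma path_succ (w : Site L) (r : Bool) (i : ℕ) :
    path w r (i + 1) = path w r i + bondDir L (altDir r i) := rfl

lemma path_succ' (w : Site L) (r : Bool) (i : ℕ) :
    path w r (i + 1) = path (w + bondDir L r) (!r) i := by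
  induction i with
  | zero => simp [path, altDir]
  | succ i ih => rw [path_succ, ih, path_succ, altDir_not]

lemma path_sum (w : Site L) (r : Bool) (i : ℕ) :
    (path w r i).1 + (path w r i).2 = w.1 + w.2 + i := by
  induction i with
  | zero => simp [path]
  | succ i ih =>
    rw [path_succ, Prod.fst_add, Prod.snd_add, Nat.cast_succ, ← bondDir_sum (altDir r i)]
    linear_combination ih

/-- The product of the `n` bond terms along the path starting at its `j`-th site. -/
def chain (w : Site L) (r : Bool) (j : ℕ) : ℕ → PSpec L
  | 0 => 0
  | n + 1 => specMul (bondSpec (path w r (j + n), altDir r (j + n))) (chain w r j n)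

lemma chain_succ (w : Site L) (r : Bool) (j n : ℕ) :
    chain w r j (n + 1) =
      specMul (bondSpec (path w r (j + n), altDir r (j + n))) (chain w r j n) := rfl

lemma chain_succ' (w : Site L) (r : Bool) (j n : ℕ) :
    chain w r j (n + 1) =
      specMul (bondSpec (path w r j, altDir r j)) (chain w r (j + 1) n) := by
  induction n with
  | zero => rfl
  | succ n ih =>
    rw [chain_succ, ih, specMul_left_comm, chain_succ]
    congr 3
    simp only [Nat.add_assoc, Nat.add_comm 1 n]

lemma chain_shift (w : Site L) (r : Bool) (j n : ℕ) :
    chain w r (j + 1) n = chain (w + bondDir L r) (!r) j n := by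
  induction n with
  | zero => rfl
  | succ n ih =>
    rw [chain_succ, chain_succ, ih, altDir_not, ← path_succ', Nat.add_right_comm]

/-- The letter of a chain at the `i`-th site of its path. -/
def chainLetter (r : Bool) (j n i : ℕ) : Fin 4 :=
  if i < j ∨ j + n < i then 0
  else if i = j then bondLetter (altDir r j)
  else if i = j + n then bondLetter (altDir r (j + n - 1))
  else 3

lemma letterMul_altDir (r : Bool) (i : ℕ) :
    letterMul (bondLetter (altDir r (i + 1))) (bondLetter (altDir r i)) = 3 := by
  rw [altDir_succ_ne]
  cases altDir r i <;> decide

lemma exists_path_of_chain_ne_zero {w : Site L} {r : Bool} {j n : ℕ} {v : Site L}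
    (h : chain w r j n v ≠ 0) : ∃ i, j ≤ i ∧ i ≤ j + n ∧ v = path w r i := by
  induction n with
  | zero => exact absurd rfl h
  | succ n ih =>
    by_cases h1 : v = path w r (j + n)
    · exact ⟨j + n, by omega, by omega, h1⟩
    by_cases h2 : v = path w r (j + n + 1)
    · exact ⟨j + n + 1, by omega, by omega, h2⟩
    rw [chain_succ, specMul_bondSpec_of_ne h1 h2] at h
    obtain ⟨i, h3, h4, h5⟩ := ih h
    exact ⟨i, h3, by omega, h5⟩

/-- The diagonal coordinate of a site relative to `a`. -/
def lev (a : ZMod L) (v : Site L) : ℕ := (v.1 + v.2 - a).val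

lemma specMul_bondSpec_of_lev {u v : Site L} {t : Bool} {τ : PSpec L} {a : ZMod L}
    (h1 : lev a v ≠ lev a u) (h2 : lev a v ≠ lev a (u + bondDir L t)) :
    specMul (bondSpec (u, t)) τ v = τ v :=
  specMul_bondSpec_of_ne (fun h => h1 (congrArg _ h)) (fun h => h2 (congrArg _ h))

/-- The chain with a side bond attached at the `M`-th site of its path. -/
def decorated (w : Site L) (r : Bool) (M j n : ℕ) : PSpec L :=
  specMul (bondSpec (path w r M, !r)) (chain w r j n)

lemma eq_of_decorated_ne_zero {w : Site L} {r : Bool} {M j : ℕ} (hjM : j ≤ M) {y : Site L}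
    (hy : decorated w r M j (M + 1) y ≠ 0) :
    y = path w r M + bondDir L (!r) ∨ ∃ i ≤ M + 1, y = path w r (j + i) := by
  by_cases h1 : y = path w r M
  · exact Or.inr ⟨M - j, by omega, by rw [h1]; congr 1; omega⟩
  by_cases h2 : y = path w r M + bondDir L (!r)
  · exact Or.inl h2
  rw [decorated, specMul_bondSpec_of_ne h1 h2] at hy
  obtain ⟨i, h3, h4, h5⟩ := exists_path_of_chain_ne_zero hy
  exact Or.inr ⟨i - j, by omega, by rw [h5]; congr 1; omega⟩

lemma specMul_decorated_first (w : Site L) (r : Bool) (M j : ℕ) :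
    specMul (bondSpec (path w r j, altDir r j)) (decorated w r M j (M + 1)) =
      decorated w r M (j + 1) M := by
  rw [decorated, specMul_left_comm, chain_succ', specMul_cancel, decorated]

lemma specMul_decorated_last (w : Site L) (r : Bool) (M j : ℕ) :
    specMul (bondSpec (path w r (j + M), altDir r (j + M))) (decorated w r M j (M + 1)) =
      decorated w r M j M := by
  rw [decorated, specMul_left_comm, chain_succ, specMul_cancel, decorated]

end Bonds

section Levels

variable {L : ℕ} [NeZero L]

lemma lev_lt (a : ZMod L) (v : Site L) : lev a v < L := ZMod.val_lt _

lemma cast_lev (a : ZMod L) (v : Site L) : (lev a v : ZMod L) = v.1 + v.2 - a :=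
  ZMod.natCast_zmod_val _

lemma lev_eq_iff {a : ZMod L} {v : Site L} {n : ℕ} (hn : n < L) :
    lev a v = n ↔ v.1 + v.2 - a = n := by
  rw [← cast_lev, ZMod.natCast_eq_natCast_iff', Nat.mod_eq_of_lt (lev_lt a v),
    Nat.mod_eq_of_lt hn]

lemma lev_add_bondDir (a : ZMod L) (v : Site L) (t : Bool) :
    lev a (v + bondDir L t) = if lev a v + 1 = L then 0 else lev a v + 1 := by
  have h : (v + bondDir L t).1 + (v + bondDir L t).2 - a = ((lev a v + 1 : ℕ) : ZMod L) := by
    rw [Nat.cast_succ, cast_lev, Prod.fst_add, Prod.snd_add, ← bondDir_sum t]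
    ring
  have hlt := lev_lt a v
  split_ifs with hs
  · rw [lev_eq_iff (by omega), h, hs]
    simp
  · rw [lev_eq_iff (by omega), h]

lemma lev_add_one (a : ZMod L) (v : Site L) :
    lev (a + 1) v = if lev a v = 0 then L - 1 else lev a v - 1 := by
  have hlt := lev_lt a v
  have h : v.1 + v.2 - (a + 1) = (lev a v : ZMod L) - 1 := by
    rw [cast_lev]; ring
  split_ifs with hs
  · rw [lev_eq_iff (by omega), h, hs, Nat.cast_sub (by omega)]
    simp
  · rw [lev_eq_iff (by omega), h, Nat.cast_sub (by omega)]
    simp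

/-- Two occupied levels at distance `K` do not fit into a window of length `K ≤ L / 2`. -/
lemma not_diagBoundAt_of_lev {K : ℕ} (hK : 2 * K ≤ L) {ρ : PSpec L} {a a' : ZMod L}
    (h : DiagBoundAt L ρ a' K) {u w : Site L} (hu : ρ u ≠ 0) (hw : ρ w ≠ 0)
    (hlev : lev a w = lev a u + K) : False := by
  have h1 : lev a' u < K := h u hu
  have h2 : lev a' w < K := h w hw
  have h3 : ((lev a w : ℕ) : ZMod L) = ((lev a u + K : ℕ) : ZMod L) := by rw [hlev]
  have h4 : ((lev a' w : ℕ) : ZMod L) = ((lev a' u + K : ℕ) : ZMod L) := by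
    push_cast [cast_lev] at h3 ⊢
    linear_combination h3
  rw [ZMod.natCast_eq_natCast_iff', Nat.mod_eq_of_lt (by omega),
    Nat.mod_eq_of_lt (by omega)] at h4
  omega

/-- The levels of `σ` lie in `[0, K]`, and both extremal levels are occupied. -/
def SpansLevels (K : ℕ) (a : ZMod L) (σ : PSpec L) : Prop :=
  (∀ v, σ v ≠ 0 → lev a v ≤ K) ∧ (∃ v, lev a v = 0 ∧ σ v ≠ 0) ∧ ∃ v, lev a v = K ∧ σ v ≠ 0

/-- A bond term anticommuting with a Pauli product of diagonal length `K + 1` and reducing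
the diagonal length deletes either the unique bottom-left or the unique top-right site. -/
lemma bottom_or_top_of_diagBoundAt {K : ℕ} (hK2 : 2 ≤ K) (hKL : 2 * K ≤ L) {a a' : ZMod L}
    {τ : PSpec L} (hτ : SpansLevels K a τ) {b : Site L × Bool} (hb : BondAnti b τ)
    (hfit : DiagBoundAt L (specMul (bondSpec b) τ) a' K) :
    (lev a b.1 = 0 ∧ τ b.1 = bondLetter b.2 ∧ ∀ v, lev a v = 0 → τ v ≠ 0 → v = b.1) ∨
    (lev a b.1 + 1 = K ∧ τ (b.1 + bondDir L b.2) = bondLetter b.2 ∧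
      ∀ v, lev a v = K → τ v ≠ 0 → v = b.1 + bondDir L b.2) := by
  obtain ⟨hle, ⟨v0, hv0, hv0'⟩, ⟨vK, hvK, hvK'⟩⟩ := hτ
  have hstep := lev_add_bondDir a b.1 b.2
  have hlt := lev_lt a b.1
  have hcase : (∀ v, lev a v = 0 → specMul (bondSpec b) τ v = 0) ∨
      (∀ v, lev a v = K → specMul (bondSpec b) τ v = 0) := by
    by_contra hcon
    push Not at hcon
    obtain ⟨⟨x, hx, hx'⟩, ⟨y, hy, hy'⟩⟩ := hcon
    exact not_diagBoundAt_of_lev hKL hfit (a := a) hx' hy' (by omega)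
  have hbl := bondLetter_ne_zero b.2
  rcases hcase with hc | hc
  · left
    have h0 := eq_of_specMul_bondSpec_eq_zero (hc v0 hv0) hv0'
    rcases h0 with ⟨rfl | rfl, hl⟩
    · refine ⟨hv0, hl, fun v hv hvne => ?_⟩
      rcases (eq_of_specMul_bondSpec_eq_zero (hc v hv) hvne).1 with h | h
      · exact h
      · rw [h, hstep] at hv
        split_ifs at hv
        omega
    · exfalso
      have hz : τ b.1 = 0 := by
        by_contra hne
        have := hle _ hne
        rw [hstep] at hv0
        split_ifs at hv0
        omega
      apply hb
      simp [hz, hl]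
  · right
    have h0 := eq_of_specMul_bondSpec_eq_zero (hc vK hvK) hvK'
    rcases h0 with ⟨rfl | rfl, hl⟩
    · exfalso
      have hz : τ (b.1 + bondDir L b.2) = 0 := by
        by_contra hne
        have := hle _ hne
        rw [hstep] at this
        split_ifs at this <;> omega
      apply hb
      simp [hz, hl]
    · have hb1 : lev a b.1 + 1 = K := by
        rw [hstep] at hvK
        split_ifs at hvK <;> omega
      refine ⟨hb1, hl, fun v hv hvne => ?_⟩
      rcases (eq_of_specMul_bondSpec_eq_zero (hc v hv) hvne).1 with h | h
      · rw [h] at hv; omega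
      · exact h

lemma lev_path {a : ZMod L} {w : Site L} {r : Bool} {i : ℕ} (h : lev a w + i < L) :
    lev a (path w r i) = lev a w + i := by
  rw [lev_eq_iff h, path_sum, Nat.cast_add, cast_lev]
  ring

lemma path_inj {w : Site L} {r : Bool} {i j : ℕ} (hi : i < L) (hj : j < L) :
    path w r i = path w r j ↔ i = j := by
  refine ⟨fun h => ?_, fun h => h ▸ rfl⟩
  have hw : lev (w.1 + w.2) w = 0 := by simp [lev]
  have h1 := lev_path (a := w.1 + w.2) (w := w) (r := r) (i := i) (by omega)
  have h2 := lev_path (a := w.1 + w.2) (w := w) (r := r) (i := j) (by omega)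
  rw [h] at h1
  omega

lemma chain_path {w : Site L} {r : Bool} {j n i : ℕ} (hn : 1 ≤ n) (hjn : j + n < L)
    (hi : i < L) : chain w r j n (path w r i) = chainLetter r j n i := by
  induction n, hn using Nat.le_induction generalizing i with
  | base =>
    have h1 : chain w r j 1 (path w r i) =
        bondSpec (path w r j, altDir r j) (path w r i) := by
      simp [chain, specMul]
    rw [h1]
    simp only [bondSpec, ← path_succ, path_inj hi (show j < L by omega),
      path_inj hi (show j + 1 < L by omega), chainLetter]
    split_ifs <;> first | omega | rfl
  | succ n hn ih =>
    rw [chain_succ, specMul, ih (by omega) hi]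
    simp only [bondSpec, ← path_succ, path_inj hi (show j + n < L by omega),
      path_inj hi (show j + n + 1 < L by omega), chainLetter]
    obtain ⟨m, rfl⟩ : ∃ m, n = m + 1 := ⟨n - 1, by omega⟩
    have hl := letterMul_altDir r (j + m)
    split_ifs <;> first
      | omega
      | (simp; done)
      | (simpa [← Nat.add_assoc] using hl)

lemma lev_path_add {w : Site L} {r : Bool} {j i : ℕ} (hi : i < L) :
    lev ((path w r j).1 + (path w r j).2) (path w r (j + i)) = i := by
  rw [lev_eq_iff hi, path_sum, path_sum]
  push_cast
  ring

lemma chain_first {w : Site L} {r : Bool} {j n : ℕ} (hn : 1 ≤ n) (hjn : j + n < L) :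
    chain w r j n (path w r j) = bondLetter (altDir r j) := by
  rw [chain_path hn hjn (by omega)]
  simp [chainLetter]

lemma chain_last {w : Site L} {r : Bool} {j n : ℕ} (hjn : j + n + 1 < L) :
    chain w r j (n + 1) (path w r (j + n + 1)) = bondLetter (altDir r (j + n)) := by
  rw [chain_path (by omega) (by omega) hjn, chainLetter, if_neg (by omega),
    if_neg (by omega), if_pos (by omega)]
  congr 2

lemma chain_interior {w : Site L} {r : Bool} {j n i : ℕ} (hjn : j + n < L) (h1 : j < i)
    (h2 : i < j + n) : chain w r j n (path w r i) = 3 := by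
  rw [chain_path (by omega) hjn (by omega), chainLetter, if_neg (by omega),
    if_neg (by omega), if_neg (by omega)]

lemma spansLevels_chain {w : Site L} {r : Bool} {j n : ℕ} (hn : 1 ≤ n) (hjn : j + n < L) :
    SpansLevels n ((path w r j).1 + (path w r j).2) (chain w r j n) := by
  refine ⟨fun v hv => ?_, ⟨path w r j, ?_, ?_⟩, ⟨path w r (j + n), lev_path_add (by omega), ?_⟩⟩
  · obtain ⟨i, h1, h2, rfl⟩ := exists_path_of_chain_ne_zero hv
    obtain ⟨i, rfl⟩ := Nat.exists_eq_add_of_le h1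
    rw [lev_path_add (by omega)]
    omega
  · exact lev_path_add (i := 0) (by omega)
  · rw [chain_first hn hjn]
    exact bondLetter_ne_zero _
  · obtain ⟨n, rfl⟩ : ∃ m, n = m + 1 := ⟨n - 1, by omega⟩
    rw [← Nat.add_assoc, chain_last hjn]
    exact bondLetter_ne_zero _

lemma spansLevels_or_diagBoundAt {K : ℕ} {σ : PSpec L} {a : ZMod L}
    (hσ : DiagBoundAt L σ a (K + 1)) :
    SpansLevels K a σ ∨ ∃ a', DiagBoundAt L σ a' K := by
  by_contra! hcon
  obtain ⟨h1, h2⟩ := hcon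
  refine h1 ⟨fun v hv => Nat.lt_succ_iff.mp (hσ v hv), ?_, ?_⟩
  · by_contra! h3
    refine h2 (a + 1) fun v hv => ?_
    have h4 : lev a v < K + 1 := hσ v hv
    have h5 : lev a v ≠ 0 := fun h0 => hv (h3 v h0)
    change lev (a + 1) v < K
    rw [lev_add_one, if_neg h5]
    omega
  · by_contra! h3
    refine h2 a fun v hv => ?_
    have h4 : lev a v < K + 1 := hσ v hv
    have h5 : lev a v ≠ K := fun h0 => hv (h3 v h0)
    change lev a v < K
    omega

section Decorated

variable {M : ℕ} {w : Site L} {r : Bool} {j : ℕ}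

lemma side_ne_path (hM : M % 2 = 0) (hML : M + 1 < L) {i : ℕ} (hi : i < L) :
    path w r M + bondDir L (!r) ≠ path w r i := by
  intro heq
  have h1 : path w r i = path w r (M + 1) := by
    have h2 : lev ((path w r 0).1 + (path w r 0).2) (path w r (0 + M)) = M :=
      lev_path_add (by omega)
    have h3 : lev ((path w r 0).1 + (path w r 0).2) (path w r (0 + i)) = i :=
      lev_path_add hi
    rw [zero_add] at h2 h3
    rw [← heq, lev_add_bondDir, h2, if_neg (by omega)] at h3
    rw [h3]
  rw [h1, path_succ, altDir, if_pos hM] at heq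
  have := bondDir_injective (by omega) (add_left_cancel heq)
  simp at this

lemma lev_side (hjM : j ≤ M) (hML : M + 1 < L) :
    lev ((path w r j).1 + (path w r j).2) (path w r M + bondDir L (!r)) = M + 1 - j := by
  obtain ⟨i, rfl⟩ := Nat.exists_eq_add_of_le hjM
  rw [lev_add_bondDir, lev_path_add (by omega), if_neg (by omega)]
  omega

lemma chain_side (hM : M % 2 = 0) (hML : M + 1 < L) {n : ℕ} (hjn : j + n < L) :
    chain w r j n (path w r M + bondDir L (!r)) = 0 := by
  by_contra hne
  obtain ⟨i, -, h2, h3⟩ := exists_path_of_chain_ne_zero hne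
  exact side_ne_path hM hML (by omega) h3

lemma decorated_side (hM : M % 2 = 0) (hML : M + 1 < L) {n : ℕ} (hjn : j + n < L) :
    decorated w r M j n (path w r M + bondDir L (!r)) = bondLetter (!r) := by
  have := specMul_bondSpec_right (path w r M, !r) (chain w r j n)
  rw [chain_side hM hML hjn, letterMul_zero] at this
  exact this

lemma decorated_path (hM : M % 2 = 0) (hML : M + 1 < L) {n i : ℕ} (hi : i < L)
    (hiM : i ≠ M) : decorated w r M j n (path w r i) = chain w r j n (path w r i) :=
  specMul_bondSpec_of_ne (by rw [Ne, path_inj hi (by omega)]; exact hiM)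
    (side_ne_path hM hML hi).symm

lemma decorated_corner_of_lt (hjM : j < M) (hjn : j + (M + 1) < L) :
    decorated w r M j (M + 1) (path w r M) = bondLetter r := by
  have := specMul_bondSpec_left (path w r M, !r) (chain w r j (M + 1))
  rw [chain_interior hjn hjM (by omega), letterMul_bondLetter_three] at this
  exact this

lemma decorated_corner_self (hM : M % 2 = 0) (hjn : M + (M + 1) < L) :
    decorated w r M M (M + 1) (path w r M) = 3 := by
  have := specMul_bondSpec_left (path w r M, !r) (chain w r M (M + 1))
  rw [chain_first (by omega) hjn, altDir, if_pos hM, letterMul_bondLetter_not] at this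
  exact this

lemma decorated_first_of_lt (hM : M % 2 = 0) (hjM : j < M) (hjn : j + (M + 1) < L) :
    decorated w r M j (M + 1) (path w r j) = bondLetter (altDir r j) := by
  rw [decorated_path hM (by omega) (by omega) (by omega), chain_first (by omega) hjn]

lemma decorated_last (hM : M % 2 = 0) (hjn : j + M + 1 < L) :
    decorated w r M j (M + 1) (path w r (j + M + 1)) = bondLetter (altDir r (j + M)) := by
  rw [decorated_path hM (by omega) (by omega) (by omega), chain_last hjn]

lemma spansLevels_decorated (hM : M % 2 = 0) (hjM : j ≤ M) (hjn : j + M + 1 < L) :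
    SpansLevels (M + 1) ((path w r j).1 + (path w r j).2) (decorated w r M j (M + 1)) := by
  refine ⟨fun y hy => ?_, ⟨path w r j, lev_path_add (i := 0) (by omega), ?_⟩,
    ⟨path w r (j + M + 1), lev_path_add (i := M + 1) (by omega), ?_⟩⟩
  · rcases eq_of_decorated_ne_zero hjM hy with rfl | ⟨i, hi, rfl⟩
    · rw [lev_side hjM (by omega)]
      omega
    · rw [lev_path_add (by omega)]
      exact hi
  · rcases hjM.lt_or_eq with h1 | rfl
    · rw [decorated_first_of_lt hM h1 hjn]
      exact bondLetter_ne_zero _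
    · rw [decorated_corner_self hM hjn]
      decide
  · rw [decorated_last hM hjn]
    exact bondLetter_ne_zero _

lemma altDir_add_even (hM : M % 2 = 0) : altDir r (j + M) = altDir r j := by
  simp [altDir, Nat.add_mod, hM]

lemma bondAnti_side (hM : M % 2 = 0) (hjM : j ≤ M) (hjn : j + M + 1 < L) :
    BondAnti (path w r M, !r) (decorated w r M j (M + 1)) := by
  rw [decorated, bondAnti_specMul_iff]
  have hside := chain_side (w := w) (r := r) (j := j) (n := M + 1) hM (by omega) (by omega)
  rcases hjM.lt_or_eq with h1 | rfl
  · have hmid := chain_interior (w := w) (r := r) (j := j) (n := M + 1) (i := M)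
      (by omega) h1 (by omega)
    refine bondAnti_of_left ?_ ?_ (Or.inl hside) <;> simp only [hmid]
    · decide
    · exact three_ne_bondLetter _
  · have hfirst := chain_first (w := w) (r := r) (j := j) (n := j + 1) (by omega) (by omega)
    refine bondAnti_of_left ?_ ?_ (Or.inl hside) <;> simp only [hfirst]
    · exact bondLetter_ne_zero _
    · simp [bondLetter_inj, altDir, hM]

lemma bondAnti_decorated_first (hM : M % 2 = 0) (hjM : j < M) (hjn : j + M + 1 < L) :
    BondAnti (path w r j, altDir r j) (decorated w r M j (M + 1)) := by
  have hfirst := decorated_first_of_lt (w := w) (r := r) hM hjM (by omega)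
  by_cases h1 : j + 1 = M
  · have hcorner := decorated_corner_of_lt (w := w) (r := r) hjM (by omega)
    refine bondAnti_of_right ?_ ?_ (Or.inr hfirst) <;>
      simp only [← path_succ, h1, hcorner]
    · exact bondLetter_ne_zero _
    · rw [Ne, bondLetter_inj, altDir, if_neg (by omega)]
      simp
  · have hmid := decorated_path (w := w) (r := r) (j := j) (n := M + 1) (i := j + 1) hM
      (by omega) (by omega) h1
    rw [chain_interior (by omega) (by omega) (by omega)] at hmid
    refine bondAnti_of_right ?_ ?_ (Or.inr hfirst) <;> simp only [← path_succ, hmid]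
    · decide
    · exact three_ne_bondLetter _

lemma bondAnti_decorated_last (hM : M % 2 = 0) (hj : 0 < j) (hjM : j ≤ M)
    (hjn : j + M + 1 < L) :
    BondAnti (path w r (j + M), altDir r (j + M)) (decorated w r M j (M + 1)) := by
  have hlast := decorated_last (w := w) (r := r) hM hjn
  have hmid := decorated_path (w := w) (r := r) (j := j) (n := M + 1) (i := j + M) hM
    (by omega) (by omega) (by omega)
  rw [chain_interior (by omega) (by omega) (by omega)] at hmid
  refine bondAnti_of_left ?_ ?_ (Or.inr hlast) <;> simp only [hmid]
  · decide
  · exact three_ne_bondLetter _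

end Decorated

end Levels

section Conserved

variable {L : ℕ} [NeZero L]

/-- The coefficients of an operator that commutes with the bond Hamiltonian with couplings `J`
and whose Pauli products have diagonal length at most `K + 1`. -/
structure IsConserved (J : Bool → ℂ) (K : ℕ) (q : PSpec L → ℂ) : Prop where
  three_le : 3 ≤ K
  two_mul_le : 2 * (K + 1) ≤ L
  coupling_ne_zero : ∀ t, J t ≠ 0
  sum_eq_zero : ∀ τ, ∑ b : Site L × Bool,
    J b.2 * bondSign b τ * q (specMul (bondSpec b) τ) = 0
  fits : ∀ σ, q σ ≠ 0 → ∃ a, DiagBoundAt L σ a (K + 1)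

namespace IsConserved

variable {J : Bool → ℂ} {K : ℕ} {q : PSpec L → ℂ}

lemma sum_subset_eq_zero (h : IsConserved J K q) {τ : PSpec L} (S : Finset (Site L × Bool))
    (hS : ∀ b, BondAnti b τ → q (specMul (bondSpec b) τ) ≠ 0 → b ∈ S) :
    ∑ b ∈ S, J b.2 * bondSign b τ * q (specMul (bondSpec b) τ) = 0 := by
  have hK := h.three_le
  have hL := h.two_mul_le
  rw [← h.sum_eq_zero τ]
  refine Finset.sum_subset (Finset.subset_univ S) fun b _ hb => ?_
  by_cases h1 : BondAnti b τ
  · by_cases h2 : q (specMul (bondSpec b) τ) = 0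
    · rw [h2, mul_zero]
    · exact absurd (hS b h1 h2) hb
  · rw [bondSign_of_not_anti (by omega) h1, mul_zero, zero_mul]

lemma bondSign_ne_zero (h : IsConserved J K q) {b : Site L × Bool} {τ : PSpec L}
    (hb : BondAnti b τ) : bondSign b τ ≠ 0 := by
  have hK := h.three_le
  have hL := h.two_mul_le
  rcases bondSign_of_anti (by omega) hb with h1 | h1 <;> simp [h1]

lemma exists_other (h : IsConserved J K q) {τ : PSpec L} {b₀ : Site L × Bool}
    (hb₀ : BondAnti b₀ τ) (hq : q (specMul (bondSpec b₀) τ) ≠ 0) :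
    ∃ b, b ≠ b₀ ∧ BondAnti b τ ∧ q (specMul (bondSpec b) τ) ≠ 0 := by
  by_contra hcon
  push Not at hcon
  have h1 := h.sum_subset_eq_zero (τ := τ) {b₀} fun b h1 h2 => by
    by_contra h3
    exact h2 (hcon b (by simpa using h3) h1)
  rw [Finset.sum_singleton] at h1
  exact mul_ne_zero (mul_ne_zero (h.coupling_ne_zero _) (h.bondSign_ne_zero hb₀)) hq h1

/-- Appending a bond at a top-right site forces a bottom-left site that can be truncated. -/
lemma exists_shift (h : IsConserved J K q) {σ : PSpec L} {a : ZMod L} {u : Site L} {t : Bool}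
    (hσ : q σ ≠ 0) (hs : SpansLevels K a σ) (hu : lev a u = K) (hu0 : σ u ≠ 0)
    (hut : σ u ≠ bondLetter t) :
    ∃ v t', lev a v = 0 ∧ σ v = bondLetter t' ∧ (∀ x, lev a x = 0 → σ x ≠ 0 → x = v) ∧
      specMul (bondSpec (u, t)) σ (v + bondDir L t') ≠ 0 ∧
      specMul (bondSpec (u, t)) σ (v + bondDir L t') ≠ bondLetter t' ∧
      q (specMul (bondSpec (v, t')) (specMul (bondSpec (u, t)) σ)) ≠ 0 ∧
      SpansLevels K (a + 1)
        (specMul (bondSpec (v, t')) (specMul (bondSpec (u, t)) σ)) := by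
  have hK := h.three_le
  have hL := h.two_mul_le
  obtain ⟨hle, ⟨v0, hv0, hv0'⟩, -⟩ := hs
  have hue : lev a (u + bondDir L t) = K + 1 := by
    rw [lev_add_bondDir, if_neg (by omega), hu]
  have hσe : σ (u + bondDir L t) = 0 := by
    by_contra hne
    have := hle _ hne
    omega
  set τ := specMul (bondSpec (u, t)) σ with hτ
  have hτe : τ (u + bondDir L t) = bondLetter t := by
    have := specMul_bondSpec_right (u, t) σ
    simpa [hσe] using this
  have hτ' : ∀ x, lev a x < K → τ x = σ x := fun x hx =>
    specMul_bondSpec_of_lev (a := a) (by omega) (by omega)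
  have hτle : ∀ x, τ x ≠ 0 → lev a x ≤ K + 1 := by
    intro x hx
    by_contra hcon
    have : τ x = σ x := specMul_bondSpec_of_lev (a := a) (by omega) (by omega)
    have := hle x (this ▸ hx)
    omega
  have hspan : SpansLevels (K + 1) a τ :=
    ⟨hτle, ⟨v0, hv0, by rwa [hτ' v0 (by omega)]⟩,
      ⟨u + bondDir L t, hue, by rw [hτe]; exact bondLetter_ne_zero t⟩⟩
  have hanti : BondAnti (u, t) τ := by
    rw [hτ, bondAnti_specMul_iff]
    exact bondAnti_of_left hu0 hut (Or.inl hσe)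
  obtain ⟨⟨v, t'⟩, hne, hba, hbq⟩ := h.exists_other (τ := τ) hanti
    (by rw [hτ, specMul_cancel]; exact hσ)
  obtain ⟨a', ha'⟩ := h.fits _ hbq
  rcases bottom_or_top_of_diagBoundAt (by omega) hL hspan hba ha' with
    ⟨hv, hvl, huniq⟩ | ⟨hv, hvl, huniq⟩
  · simp only at hv hvl huniq
    have hve : lev a (v + bondDir L t') = 1 := by
      rw [lev_add_bondDir, if_neg (by omega), hv]
    have hright : τ (v + bondDir L t') ≠ 0 ∧ τ (v + bondDir L t') ≠ bondLetter t' := by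
      have hba' := hba
      unfold BondAnti at hba'
      simp only [hvl] at hba'
      tauto
    have hσ1 : ∀ x, 1 < lev a x → specMul (bondSpec (v, t')) τ x = τ x := fun x hx =>
      specMul_bondSpec_of_lev (a := a) (by omega) (by omega)
    refine ⟨v, t', hv, by rw [← hτ' v (by omega), hvl],
      fun x hx hx0 => huniq x hx (by rwa [hτ' x (by omega)]), hright.1, hright.2, hbq,
      fun x hx => ?_, ⟨v + bondDir L t', ?_, ?_⟩, ⟨u + bondDir L t, ?_, ?_⟩⟩
    · by_cases hx0 : lev a x = 0
      · exfalso
        apply hx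
        by_cases hxv : x = v
        · rw [hxv]
          have := specMul_bondSpec_left (v, t') τ
          rw [hvl] at this
          rw [this, letterMul_eq_zero]
        · rw [specMul_bondSpec_of_ne (by simpa using hxv)
            (by rintro rfl; simp only at hx0; omega)]
          by_contra hne'
          exact hxv (huniq x hx0 hne')
      · rw [lev_add_one, if_neg hx0]
        by_cases hx1 : 1 < lev a x
        · rw [hσ1 x hx1] at hx
          have := hτle x hx
          omega
        · omega
    · rw [lev_add_one, if_neg (by omega), hve]
    · have := specMul_bondSpec_right (v, t') τ
      rw [this, Ne, letterMul_eq_zero]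
      exact hright.2.symm
    · rw [lev_add_one, if_neg (by omega), hue]
      omega
    · rw [hσ1 _ (by omega), hτe]
      exact bondLetter_ne_zero t
  · exfalso
    apply hne
    simp only at hv hvl huniq
    have h1 := huniq (u + bondDir L t) hue (by rw [hτe]; exact bondLetter_ne_zero t)
    rw [← h1, hτe, bondLetter_inj] at hvl
    rw [hvl] at h1 ⊢
    rw [add_right_cancel h1]

lemma lev_eq_of_chain_ne_zero {a : ZMod L} {x y : Site L} {r : Bool} {n : ℕ}
    (hlt : lev a x + n < L) (hy : chain x r 0 n y ≠ 0) :
    ∃ i ≤ n, y = path x r i ∧ lev a y = lev a x + i := by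
  obtain ⟨i, -, hi, rfl⟩ := exists_path_of_chain_ne_zero hy
  exact ⟨i, by omega, rfl, lev_path (by omega)⟩

/-- A Pauli product with a standard-form shift is itself of standard form. -/
lemma eq_chain_of_shift (h : IsConserved J K q) {σ : PSpec L} {a : ZMod L} {u v x : Site L}
    {t t' r : Bool} (hs : SpansLevels K a σ) (hu : lev a u = K) (hv : lev a v = 0)
    (h0 : specMul (bondSpec (u, t)) σ (v + bondDir L t') ≠ 0)
    (h1 : specMul (bondSpec (u, t)) σ (v + bondDir L t') ≠ bondLetter t')
    (hx : lev (a + 1) x = 0)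
    (hch : specMul (bondSpec (v, t')) (specMul (bondSpec (u, t)) σ) = chain x r 0 K) :
    σ = chain v t' 0 K := by
  have hK := h.three_le
  have hL := h.two_mul_le
  have hve : lev a (v + bondDir L t') = 1 := by
    rw [lev_add_bondDir, if_neg (by omega), hv]
  have hσe : σ (u + bondDir L t) = 0 := by
    by_contra hne
    have := hs.1 _ hne
    rw [lev_add_bondDir, if_neg (by omega)] at this
    omega
  have hue : lev a (u + bondDir L t) = K + 1 := by
    rw [lev_add_bondDir, if_neg (by omega), hu]
  set τ := specMul (bondSpec (u, t)) σ with hτ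
  have hτe : τ (u + bondDir L t) = bondLetter t := by
    have := specMul_bondSpec_right (u, t) σ
    simpa [hσe] using this
  have hval : chain x r 0 K (v + bondDir L t') =
      letterMul (bondLetter t') (τ (v + bondDir L t')) := by
    rw [← hch]
    exact specMul_bondSpec_right (v, t') τ
  have hxv : v + bondDir L t' = x := by
    have hne : chain x r 0 K (v + bondDir L t') ≠ 0 := by
      rw [hval, Ne, letterMul_eq_zero]
      exact h1.symm
    obtain ⟨i, -, hi, hi'⟩ := lev_eq_of_chain_ne_zero (a := a + 1) (by omega) hne
    rw [hx, lev_add_one, if_neg (by omega), hve] at hi'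
    obtain rfl : i = 0 := by omega
    exact hi
  have hr : r = !t' := by
    have h2 : chain x r 0 K (path x r 0) = bondLetter r := by
      rw [chain_path (by omega) (by omega) (by omega)]
      simp [chainLetter, altDir]
    rw [hxv] at hval h0 h1
    rw [show path x r 0 = x from rfl, hval] at h2
    have aux : ∀ (t' r : Bool) (c : Fin 4), c ≠ 0 →
        letterMul (bondLetter t') c = bondLetter r → r = !t' := by decide
    exact aux _ _ _ h0 h2
  have hτc : τ = chain v t' 0 (K + 1) := by
    rw [chain_succ', chain_shift, show altDir t' 0 = t' from rfl, show path v t' 0 = v from rfl,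
      hxv, ← hr, ← hch, specMul_cancel]
  have hup : u + bondDir L t = path v t' (K + 1) := by
    have hne : chain v t' 0 (K + 1) (u + bondDir L t) ≠ 0 := by
      rw [← hτc, hτe]
      exact bondLetter_ne_zero t
    obtain ⟨i, -, hi, hi'⟩ := lev_eq_of_chain_ne_zero (a := a) (by omega) hne
    obtain rfl : i = K + 1 := by omega
    exact hi
  have htt : t = altDir t' K := by
    rw [hup, hτc, chain_path (by omega) (by omega) (by omega)] at hτe
    rw [← bondLetter_inj, ← hτe]
    simp [chainLetter]
  have huu : u = path v t' K := by
    rw [path_succ, ← htt] at hup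
    exact add_right_cancel hup
  rw [← specMul_cancel (bondSpec (u, t)) σ, ← hτ, hτc, chain_succ, zero_add, ← htt, ← huu,
    specMul_cancel]

/-- Above level `K - n`, the Pauli product `σ` is a staircase. -/
def TopChain (K : ℕ) (a : ZMod L) (σ : PSpec L) (n : ℕ) : Prop :=
  ∃ x r, lev a x + n = K ∧ σ x ≠ 0 ∧ σ (path x r n) ≠ 0 ∧
    σ (path x r n) ≠ bondLetter (altDir r n) ∧
    ∀ v, K < lev a v + n → σ v = chain x r 0 n v

lemma exists_chain_of_topChain (h : IsConserved J K q) {σ : PSpec L} {a : ZMod L} {n : ℕ}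
    (hn : n ≤ K) (hσ : q σ ≠ 0) (hs : SpansLevels K a σ) (hT : TopChain K a σ n) :
    ∃ x r, lev a x = 0 ∧ σ = chain x r 0 K := by
  have hK := h.three_le
  have hL := h.two_mul_le
  induction hm : K - n generalizing σ a n with
  | zero =>
    obtain rfl : n = K := by omega
    obtain ⟨x, r, hx, hx0, hp0, hp1, hc⟩ := hT
    have hpl : lev a (path x r n) = n := by rw [lev_path (by omega)]; omega
    obtain ⟨v, t', hv, hvl, huniq, h0, -, -, -⟩ := h.exists_shift hσ hs hpl hp0 hp1
    obtain rfl := huniq x (by omega) hx0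
    have hxe : lev a (x + bondDir L t') = 1 := by
      rw [lev_add_bondDir, if_neg (by omega), hv]
    rw [specMul_bondSpec_of_ne (by rintro h1; simp only at h1; rw [h1] at hxe; omega)
      (by rintro h1; simp only at h1; rw [h1, ← path_succ, lev_path (by omega)] at hxe; omega),
      hc _ (by omega)] at h0
    obtain ⟨i, -, hi, hi'⟩ := lev_eq_of_chain_ne_zero (a := a) (by omega) h0
    obtain rfl : i = 1 := by omega
    have htr : t' = r := bondDir_injective (by omega) (add_left_cancel hi)
    refine ⟨x, r, hv, funext fun y => ?_⟩
    by_cases hy : lev a y = 0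
    · by_cases hyx : y = x
      · have h2 : chain x r 0 n (path x r 0) = bondLetter r := by
          rw [chain_path (by omega) (by omega) (by omega)]
          simp [chainLetter, altDir]
        rw [hyx, hvl, htr]
        exact h2.symm
      · have h3 : σ y = 0 := by
          by_contra hne
          exact hyx (huniq y hy hne)
        have h4 : chain x r 0 n y = 0 := by
          by_contra hne
          obtain ⟨i, -, hi, hi'⟩ := lev_eq_of_chain_ne_zero (a := a) (by omega) hne
          obtain rfl : i = 0 := by omega
          exact hyx hi
        rw [h3, h4]
    · exact hc y (by omega)
  | succ m ih =>
    obtain ⟨x, r, hx, hx0, hp0, hp1, hc⟩ := hT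
    have hpl : lev a (path x r n) = K := by rw [lev_path (by omega)]; omega
    have hpl' : lev a (path x r (n + 1)) = K + 1 := by rw [lev_path (by omega)]; omega
    obtain ⟨v, t', hv, hvl, huniq, h0, h1, hq1, hs1⟩ := h.exists_shift hσ hs hpl hp0 hp1
    set τ := specMul (bondSpec (path x r n, altDir r n)) σ with hτ
    have hve : lev a (v + bondDir L t') = 1 := by
      rw [lev_add_bondDir, if_neg (by omega), hv]
    have hσ1 : ∀ y, 1 < lev a y → specMul (bondSpec (v, t')) τ y = τ y := fun x hx =>
      specMul_bondSpec_of_lev (a := a) (by omega) (by omega)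
    have hT1 : TopChain K (a + 1) (specMul (bondSpec (v, t')) τ) (n + 1) := by
      have htop : specMul (bondSpec (v, t')) τ (path x r (n + 1)) =
          bondLetter (altDir r n) := by
        rw [hσ1 _ (by omega)]
        have h2 : σ (path x r (n + 1)) = 0 := by
          by_contra hne
          have := hs.1 _ hne
          omega
        have := specMul_bondSpec_right (path x r n, altDir r n) σ
        simp only [← path_succ, h2, letterMul_zero] at this
        exact this
      refine ⟨x, r, ?_, fun hz => ?_, ?_, ?_, fun y hy => ?_⟩
      · rw [lev_add_one, if_neg (by omega)]
        omega
      · have hτx : τ x ≠ 0 := by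
          intro hz'
          obtain ⟨h2 | h2, h3⟩ := eq_of_specMul_bondSpec_eq_zero hz' hx0
          · simp only at h2 h3
            rw [← h2] at hp1
            exact hp1 h3
          · simp only [← path_succ] at h2
            rw [h2] at hx
            omega
        obtain ⟨h2 | h2, h3⟩ := eq_of_specMul_bondSpec_eq_zero hz hτx
        · simp only at h2
          rw [h2] at hx
          omega
        · simp only at h2 h3
          rw [h2] at h3
          exact h1 h3
      · rw [htop]
        exact bondLetter_ne_zero _
      · rw [htop, altDir_succ_ne, Ne, bondLetter_inj]
        simp
      · have hylt := lev_lt a y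
        rw [lev_add_one] at hy
        split_ifs at hy with hy0
        · have h2 : specMul (bondSpec (v, t')) τ y = 0 := by
            by_contra hne
            have := hs1.1 y hne
            rw [lev_add_one, if_pos hy0] at this
            omega
          have h3 : chain x r 0 (n + 1) y = 0 := by
            by_contra hne
            obtain ⟨i, -, -, hi'⟩ := lev_eq_of_chain_ne_zero (a := a) (by omega) hne
            omega
          rw [h2, h3]
        · rw [hσ1 y (by omega), hτ, chain_succ, zero_add, specMul, specMul, hc y (by omega)]
    obtain ⟨x', r', hx', hch⟩ := ih (by omega) hq1 hs1 hT1 (by omega)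
    exact ⟨v, t', hv, h.eq_chain_of_shift hs hpl hv h0 h1 hx' hch⟩

/-- Every Pauli product of maximal diagonal length with a nonzero coefficient is of
standard form. -/
lemma exists_chain (h : IsConserved J K q) {σ : PSpec L} {a : ZMod L} (hσ : q σ ≠ 0)
    (hs : SpansLevels K a σ) : ∃ x r, lev a x = 0 ∧ σ = chain x r 0 K := by
  have hL := h.two_mul_le
  obtain ⟨u, hu, hu0⟩ := hs.2.2
  obtain ⟨r, hr⟩ : ∃ r, σ u ≠ bondLetter r := by
    generalize σ u = c
    revert c
    decide
  refine h.exists_chain_of_topChain (n := 0) (by omega) hσ hs ⟨u, r, hu, hu0, hu0, hr, ?_⟩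
  intro v hv
  by_contra hne
  have := hs.1 v (by simpa [chain] using hne)
  omega

lemma exists_intSign (h : IsConserved J K q) {b : Site L × Bool} {τ : PSpec L}
    (hb : BondAnti b τ) : ∃ s : ℤ, (s = 1 ∨ s = -1) ∧ bondSign b τ = s := by
  have hK := h.three_le
  have hL := h.two_mul_le
  rcases bondSign_of_anti (by omega) hb with h1 | h1
  · exact ⟨1, Or.inl rfl, by simp [h1]⟩
  · exact ⟨-1, Or.inr rfl, by simp [h1]⟩

/-- The coefficients of two consecutive standard-form products along a staircase. -/
lemma chain_relation (h : IsConserved J K q) (w : Site L) (r : Bool) {j : ℕ}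
    (hj : j + K + 1 < L) : ∃ s s' : ℤ, (s = 1 ∨ s = -1) ∧ (s' = 1 ∨ s' = -1) ∧
      J (altDir r (j + K)) * s * q (chain w r j K) +
        J (altDir r j) * s' * q (chain w r (j + 1) K) = 0 := by
  have hK := h.three_le
  have hL := h.two_mul_le
  have hspan := spansLevels_chain (w := w) (r := r) (j := j) (n := K + 1) (by omega) (by omega)
  have hfirst := chain_first (w := w) (r := r) (j := j) (n := K + 1) (by omega) (by omega)
  have hlast := chain_last (w := w) (r := r) (j := j) (n := K) (by omega)
  have hmid1 := chain_interior (w := w) (r := r) (j := j) (n := K + 1) (i := j + 1)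
    (by omega) (by omega) (by omega)
  have hmid2 := chain_interior (w := w) (r := r) (j := j) (n := K + 1) (i := j + K)
    (by omega) (by omega) (by omega)
  have hb1 : BondAnti (path w r (j + K), altDir r (j + K)) (chain w r j (K + 1)) := by
    refine bondAnti_of_left ?_ ?_ (Or.inr hlast) <;> simp only [hmid2]
    · decide
    · exact three_ne_bondLetter _
  have hb2 : BondAnti (path w r j, altDir r j) (chain w r j (K + 1)) := by
    refine bondAnti_of_right ?_ ?_ (Or.inr hfirst) <;> simp only [← path_succ, hmid1]
    · decide
    · exact three_ne_bondLetter _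
  obtain ⟨s, hs, hs'⟩ := h.exists_intSign hb1
  obtain ⟨t, ht, ht'⟩ := h.exists_intSign hb2
  refine ⟨s, t, hs, ht, ?_⟩
  have hsum := h.sum_subset_eq_zero (τ := chain w r j (K + 1))
    {(path w r (j + K), altDir r (j + K)), (path w r j, altDir r j)} fun b hb hq => by
      obtain ⟨a', ha'⟩ := h.fits _ hq
      rw [Finset.mem_insert, Finset.mem_singleton]
      rcases bottom_or_top_of_diagBoundAt (by omega) hL hspan hb ha' with
        ⟨-, hv, huniq⟩ | ⟨-, hv, huniq⟩
      · right
        have h1 := huniq (path w r j) (lev_path_add (i := 0) (by omega))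
          (by rw [hfirst]; exact bondLetter_ne_zero _)
        rw [← h1, hfirst, bondLetter_inj] at hv
        exact Prod.ext h1.symm hv.symm
      · left
        have h1 := huniq (path w r (j + K + 1)) (lev_path_add (i := K + 1) (by omega))
          (by rw [hlast]; exact bondLetter_ne_zero _)
        rw [← h1, hlast, bondLetter_inj] at hv
        rw [path_succ, hv] at h1
        exact Prod.ext (add_right_cancel h1).symm hv.symm
  rw [Finset.sum_pair, hs', ht'] at hsum
  · rw [chain_succ, specMul_cancel] at hsum
    rw [← chain_succ, chain_succ', specMul_cancel] at hsum
    exact hsum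
  · intro heq
    have := congrArg Prod.fst heq
    rw [path_inj (by omega) (by omega)] at this
    omega

section Decorated

variable {M : ℕ} {w : Site L} {r : Bool} {j : ℕ}

/-- The bonds connecting a decorated chain to nonvanishing coefficients. -/
lemma bond_of_decorated (h : IsConserved J (M + 1) q) (hM : M % 2 = 0) (hjM : j ≤ M)
    {b : Site L × Bool} (hb : BondAnti b (decorated w r M j (M + 1)))
    (hq : q (specMul (bondSpec b) (decorated w r M j (M + 1))) ≠ 0) :
    b = (path w r M, !r) ∨ (j < M ∧ b = (path w r j, altDir r j)) ∨
      (0 < j ∧ b = (path w r (j + M), altDir r (j + M))) := by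
  have hK := h.three_le
  have hL := h.two_mul_le
  have hspan := spansLevels_decorated (w := w) (r := r) hM hjM (by omega)
  have hside := decorated_side (w := w) (r := r) (j := j) hM (by omega)
    (n := M + 1) (by omega)
  have hsl := lev_side (w := w) (r := r) hjM (by omega)
  have hrM : altDir r M = r := by rw [altDir, if_pos hM]
  set e := path w r M + bondDir L (!r) with he
  have hes : e ≠ path w r (M + 1) := side_ne_path hM (by omega) (by omega)
  obtain ⟨a', ha'⟩ := h.fits _ hq
  rcases spansLevels_or_diagBoundAt ha' with hspan' | ⟨a'', ha''⟩
  · obtain ⟨x, r', hx, hch⟩ := h.exists_chain hq hspan'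
    have hlev : lev a' e = lev a' (path w r (M + 1)) := by
      rw [he, lev_add_bondDir, path_succ, lev_add_bondDir]
    have hzero : specMul (bondSpec b) (decorated w r M j (M + 1)) e = 0 ∨
        specMul (bondSpec b) (decorated w r M j (M + 1)) (path w r (M + 1)) = 0 := by
      rw [hch]
      by_contra! hcon
      obtain ⟨i, -, h1, h2⟩ := lev_eq_of_chain_ne_zero (a := a') (by omega) hcon.1
      obtain ⟨i', -, h1', h2'⟩ := lev_eq_of_chain_ne_zero (a := a') (by omega) hcon.2
      obtain rfl : i = i' := by omega
      exact hes (h1.trans h1'.symm)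
    rcases hzero with hz | hz
    · obtain ⟨h1, h2⟩ := eq_of_specMul_bondSpec_eq_zero hz
        (by rw [hside]; exact bondLetter_ne_zero _)
      rw [hside, bondLetter_inj] at h2
      rcases h1 with h1 | h1
      · exfalso
        have h3 : decorated w r M j (M + 1) (b.1 + bondDir L b.2) ≠ 0 := by
          intro h0
          rw [← h1, ← h2] at h0
          apply hb
          simp [h0, ← h1, ← h2, hside]
        rw [← h1, ← h2] at h3
        have h4 := lev_add_bondDir ((path w r j).1 + (path w r j).2) e (!r)
        rw [hsl, if_neg (by omega)] at h4
        rcases eq_of_decorated_ne_zero hjM h3 with h5 | ⟨i, hi, h5⟩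
        · rw [h5, hsl] at h4
          omega
        · rw [h5, lev_path_add (by omega)] at h4
          rw [h4, show j + (M + 1 - j + 1) = M + 1 + 1 by omega, path_succ, altDir_succ_ne,
            hrM] at h5
          exact hes (add_right_cancel h5)
      · left
        rw [he, ← h2] at h1
        exact Prod.ext (add_right_cancel h1).symm h2.symm
    · exfalso
      have hpath := decorated_path (w := w) (r := r) (j := j) hM (by omega)
        (n := M + 1) (i := M + 1) (by omega) (by omega)
      rcases Nat.eq_zero_or_pos j with rfl | hj
      · have hlast := decorated_last (w := w) (r := r) (j := 0) hM (by omega)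
        have hcorner := decorated_corner_of_lt (w := w) (r := r) (j := 0) (M := M)
          (by omega) (by omega)
        simp only [zero_add, hrM] at hlast
        obtain ⟨h1, h2⟩ := eq_of_specMul_bondSpec_eq_zero hz
          (by rw [hlast]; exact bondLetter_ne_zero _)
        rw [hlast, bondLetter_inj] at h2
        rcases h1 with h1 | h1
        · have h3 : decorated w r M 0 (M + 1) (b.1 + bondDir L b.2) ≠ 0 := by
            intro h0
            rw [← h1, ← h2] at h0
            apply hb
            simp [h0, ← h1, ← h2, hlast]
          have h4 := hspan.1 _ h3
          rw [← h1, lev_add_bondDir, ← zero_add (M + 1), lev_path_add (by omega),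
            if_neg (by omega)] at h4
          omega
        · rw [path_succ, hrM, ← h2] at h1
          apply hb
          rw [← h2, ← add_right_cancel h1]
          rw [path_succ, hrM] at hlast
          simp [hlast, hcorner]
      · rw [chain_interior (by omega) (by omega) (by omega)] at hpath
        obtain ⟨-, h2⟩ := eq_of_specMul_bondSpec_eq_zero hz (by rw [hpath]; decide)
        rw [hpath] at h2
        exact three_ne_bondLetter _ h2
  · rcases bottom_or_top_of_diagBoundAt (by omega) (by omega) hspan hb ha'' with
      ⟨-, hv, huniq⟩ | ⟨-, hv, huniq⟩
    · rcases hjM.lt_or_eq with hlt | rfl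
      · have hfirst := decorated_first_of_lt (w := w) (r := r) hM hlt (by omega)
        have h1 := huniq (path w r j) (lev_path_add (i := 0) (by omega))
          (by rw [hfirst]; exact bondLetter_ne_zero _)
        rw [← h1, hfirst, bondLetter_inj] at hv
        exact Or.inr (Or.inl ⟨hlt, Prod.ext h1.symm hv.symm⟩)
      · exfalso
        have hcorner := decorated_corner_self (w := w) (r := r) hM (by omega)
        have h1 := huniq (path w r j) (lev_path_add (i := 0) (by omega))
          (by rw [hcorner]; decide)
        rw [← h1, hcorner] at hv
        exact three_ne_bondLetter _ hv
    · have hlast := decorated_last (w := w) (r := r) (j := j) hM (by omega)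
      have h1 := huniq (path w r (j + M + 1)) (lev_path_add (i := M + 1) (by omega))
        (by rw [hlast]; exact bondLetter_ne_zero _)
      rcases Nat.eq_zero_or_pos j with rfl | hj
      · exfalso
        have h2 := huniq e (by rw [hsl]; rfl) (by rw [hside]; exact bondLetter_ne_zero _)
        rw [← h1, zero_add] at h2
        exact hes h2
      · rw [← h1, hlast, bondLetter_inj] at hv
        rw [path_succ, hv] at h1
        exact Or.inr (Or.inr ⟨hj, Prod.ext (add_right_cancel h1).symm hv.symm⟩)

/-- The coefficient of a decorated chain of length `M` covering the `M`-th site of its path. -/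
def decoratedCoeff (q : PSpec L → ℂ) (w : Site L) (r : Bool) (M j : ℕ) : ℂ :=
  if 0 < j ∧ j ≤ M then q (decorated w r M j M) else 0

lemma decorated_relation (h : IsConserved J (M + 1) q) (hM : M % 2 = 0) (hjM : j ≤ M) :
    ∃ s s' s'' : ℤ, (s = 1 ∨ s = -1) ∧ (s' = 1 ∨ s' = -1) ∧ (s'' = 1 ∨ s'' = -1) ∧
      J (!r) * s * q (chain w r j (M + 1)) +
        J (altDir r j) * (s' * decoratedCoeff q w r M (j + 1) +
          s'' * decoratedCoeff q w r M j) = 0 := by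
  have hK := h.three_le
  have hL := h.two_mul_le
  obtain ⟨s, hs, hs1⟩ := h.exists_intSign
    (bondAnti_side (w := w) (r := r) hM hjM (by omega))
  have hside : specMul (bondSpec (path w r M, !r)) (decorated w r M j (M + 1)) =
      chain w r j (M + 1) := specMul_cancel _ _
  have hmem := fun b => h.bond_of_decorated (w := w) (r := r) (b := b) hM hjM
  have hsum := fun S => h.sum_subset_eq_zero (τ := decorated w r M j (M + 1)) S
  have hinj : ∀ i < L, ∀ i' < L, ∀ t t' : Bool, i ≠ i' → (path w r i, t) ≠ (path w r i', t') := by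
    intro i hi i' hi' t t' hne heq
    exact hne ((path_inj hi hi').mp (congrArg Prod.fst heq))
  have hfirst : j < M → ∃ s' : ℤ, (s' = 1 ∨ s' = -1) ∧
      bondSign (path w r j, altDir r j) (decorated w r M j (M + 1)) = s' := fun hlt =>
    h.exists_intSign (bondAnti_decorated_first hM hlt (by omega))
  have hlast : 0 < j → ∃ s' : ℤ, (s' = 1 ∨ s' = -1) ∧
      bondSign (path w r (j + M), altDir r (j + M)) (decorated w r M j (M + 1)) = s' :=
    fun hj => h.exists_intSign (bondAnti_decorated_last hM hj hjM (by omega))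
  rcases Nat.eq_zero_or_pos j with rfl | hj
  · obtain ⟨s', hs', hs1'⟩ := hfirst (by omega)
    refine ⟨s, s', 1, hs, hs', Or.inl rfl, ?_⟩
    have := hsum {(path w r M, !r), (path w r 0, altDir r 0)} fun b hb hq => by
      rcases hmem b hb hq with h1 | ⟨-, h1⟩ | ⟨h1, -⟩
      · simp [h1]
      · simp [h1]
      · omega
    rw [Finset.sum_pair (hinj _ (by omega) _ (by omega) _ _ (by omega)), hs1, hs1', hside,
      specMul_decorated_first] at this
    rw [decoratedCoeff, decoratedCoeff, if_pos (by omega), if_neg (by omega)]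
    linear_combination this
  · obtain ⟨s'', hs'', hs1''⟩ := hlast hj
    rcases hjM.lt_or_eq with hlt | rfl
    · obtain ⟨s', hs', hs1'⟩ := hfirst hlt
      refine ⟨s, s', s'', hs, hs', hs'', ?_⟩
      have := hsum {(path w r M, !r), (path w r j, altDir r j),
          (path w r (j + M), altDir r (j + M))} fun b hb hq => by
        rcases hmem b hb hq with h1 | ⟨-, h1⟩ | ⟨-, h1⟩ <;> simp [h1]
      rw [Finset.sum_insert (by
          simp only [Finset.mem_insert, Finset.mem_singleton, not_or]
          exact ⟨hinj _ (by omega) _ (by omega) _ _ (by omega),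
            hinj _ (by omega) _ (by omega) _ _ (by omega)⟩),
        Finset.sum_pair (hinj _ (by omega) _ (by omega) _ _ (by omega)), hs1, hs1', hs1'',
        hside, specMul_decorated_first, specMul_decorated_last, altDir_add_even hM] at this
      rw [decoratedCoeff, decoratedCoeff, if_pos (by omega), if_pos (by omega)]
      linear_combination this
    · refine ⟨s, 1, s'', hs, Or.inl rfl, hs'', ?_⟩
      have := hsum {(path w r j, !r), (path w r (j + j), altDir r (j + j))} fun b hb hq => by
        rcases hmem b hb hq with h1 | ⟨h1, -⟩ | ⟨-, h1⟩
        · simp [h1]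
        · omega
        · simp [h1]
      rw [Finset.sum_pair (hinj _ (by omega) _ (by omega) _ _ (by omega)), hs1, hs1'',
        hside, specMul_decorated_last, altDir_add_even hM] at this
      rw [decoratedCoeff, decoratedCoeff, if_neg (by omega), if_pos (by omega)]
      linear_combination this

/-- The coefficients of the standard-form products along a staircase agree up to sign and
a coupling constant. -/
lemma exists_sign_chain (h : IsConserved J (M + 1) q) (hM : M % 2 = 0) (hjM : j ≤ M) :
    ∃ e : ℤ, (e = 1 ∨ e = -1) ∧
      J r * q (chain w r j (M + 1)) = e * J (altDir r j) * q (chain w r 0 (M + 1)) := by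
  have hL := h.two_mul_le
  induction j with
  | zero => exact ⟨1, Or.inl rfl, by simp [altDir]⟩
  | succ j ih =>
    obtain ⟨e, he, heq⟩ := ih (by omega)
    obtain ⟨s, s', hs, hs', hrel⟩ := h.chain_relation w r (j := j) (by omega)
    rw [show j + (M + 1) = j + 1 + M by omega, altDir_add_even hM] at hrel
    have hs2 : (s' : ℂ) * s' = 1 := by rcases hs' with rfl | rfl <;> simp
    refine ⟨-(s' * s * e), by rcases he with rfl | rfl <;> rcases hs with rfl | rfl <;>
      rcases hs' with rfl | rfl <;> simp, ?_⟩
    refine mul_left_cancel₀ (h.coupling_ne_zero (altDir r j)) ?_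
    push_cast
    linear_combination J r * s' * hrel - J (altDir r (j + 1)) * s * s' * heq
      - J r * J (altDir r j) * q (chain w r (j + 1) (M + 1)) * hs2

lemma exists_int_decoratedCoeff (h : IsConserved J (M + 1) q) (hM : M % 2 = 0)
    (hjM : j ≤ M + 1) : ∃ n : ℤ, (n - j) % 2 = 0 ∧
      J r * decoratedCoeff q w r M j = n * J (!r) * q (chain w r 0 (M + 1)) := by
  induction j with
  | zero => exact ⟨0, rfl, by simp [decoratedCoeff]⟩
  | succ j ih =>
    obtain ⟨n, hn, heq⟩ := ih (by omega)
    obtain ⟨e, he, hchain⟩ := h.exists_sign_chain (w := w) (r := r) (j := j) hM (by omega)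
    obtain ⟨s, s', s'', hs, hs', hs'', hrel⟩ :=
      h.decorated_relation (w := w) (r := r) (j := j) hM (by omega)
    have hs2 : (s' : ℂ) * s' = 1 := by rcases hs' with rfl | rfl <;> simp
    refine ⟨-(s' * (s * e + s'' * n)), ?_, ?_⟩
    · push_cast
      rcases he with rfl | rfl <;> rcases hs with rfl | rfl <;>
        rcases hs' with rfl | rfl <;> rcases hs'' with rfl | rfl <;> omega
    · refine mul_left_cancel₀ (h.coupling_ne_zero (altDir r j)) ?_
      push_cast
      linear_combination J r * s' * hrel - J (!r) * s * s' * hchain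
        - J (altDir r j) * s' * s'' * heq
        - J r * J (altDir r j) * decoratedCoeff q w r M (j + 1) * hs2

lemma coeff_chain_eq_zero (h : IsConserved J (M + 1) q) (hM : M % 2 = 0) :
    q (chain w r 0 (M + 1)) = 0 := by
  obtain ⟨n, hn, heq⟩ := h.exists_int_decoratedCoeff (w := w) (r := r) (j := M + 1) hM le_rfl
  rw [decoratedCoeff, if_neg (by omega), mul_zero] at heq
  have hn0 : (n : ℂ) ≠ 0 := by
    rw [Int.cast_ne_zero]
    omega
  exact (mul_eq_zero.mp heq.symm).resolve_left (mul_ne_zero hn0 (h.coupling_ne_zero _))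

lemma coeff_eq_zero (h : IsConserved J (M + 1) q) (hM : M % 2 = 0) {σ : PSpec L}
    {a : ZMod L} (hs : SpansLevels (M + 1) a σ) : q σ = 0 := by
  by_contra hq
  obtain ⟨x, r, -, rfl⟩ := h.exists_chain hq hs
  exact hq (h.coeff_chain_eq_zero hM)

end Decorated

end IsConserved

lemma exists_diagBoundAt (σ : PSpec L) : ∃ a, DiagBoundAt L σ a (Diag L σ) :=
  Nat.sInf_mem (s := {k | ∃ a, DiagBoundAt L σ a k}) ⟨L, 0, fun _ _ => ZMod.val_lt _⟩

lemma isConserved_of_opComm_eq_zero {Jx Jy : ℝ} (hJx : Jx ≠ 0) (hJy : Jy ≠ 0) {K : ℕ}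
    (hK : 3 ≤ K) (hKL : 2 * (K + 1) ≤ L) {q : PSpec L → ℂ}
    (hsupp : ∀ σ : PSpec L, q σ ≠ 0 → Diag L σ ≤ K + 1)
    (hcons : opComm L (Hcompass L Jx Jy) (Qop L q) = 0) :
    IsConserved (coupling Jx Jy) K q where
  three_le := hK
  two_mul_le := hKL
  coupling_ne_zero t := by cases t <;> simpa [coupling]
  sum_eq_zero := sum_bondSign_eq_zero hcons
  fits σ hσ := by
    obtain ⟨a, ha⟩ := exists_diagBoundAt σ
    exact ⟨a, fun u hu => (ha u hu).trans_le (hsupp σ hσ)⟩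

end Conserved

lemma diag_le_of_diagBoundAt {L : ℕ} {σ : PSpec L} {a : ZMod L} {k : ℕ}
    (h : DiagBoundAt L σ a k) : Diag L σ ≤ k :=
  Nat.sInf_le ⟨a, h⟩

lemma stair_sum {L : ℕ} (u1 : Site L) {j : ℕ} (hj : 1 ≤ j) :
    (stair L u1 j).1 + (stair L u1 j).2 + 1 = u1.1 + u1.2 + j := by
  rcases Nat.even_or_odd' j with ⟨m, rfl | rfl⟩
  · rw [stair, if_neg (by omega), Nat.mul_div_cancel_left _ two_pos]
    simp only [Prod.fst_sub, Prod.snd_sub, Prod.fst_add, Prod.snd_add]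
    push_cast
    ring
  · rw [stair, if_pos (by omega), Nat.add_sub_cancel, Nat.mul_div_cancel_left _ two_pos]
    simp only [Prod.fst_add, Prod.snd_add]
    push_cast
    ring

lemma Cspec_first {L k j : ℕ} (u1 : Site L) : Cspec L k j u1 (stair L u1 j) ≠ 0 := by
  rw [Cspec, if_pos rfl, endL]
  split_ifs <;> decide

lemma Cspec_last {L k j : ℕ} (u1 : Site L) :
    Cspec L k j u1 (stair L u1 (j + k - 1)) ≠ 0 := by
  rw [Cspec, endL, endR]
  split_ifs <;> first | decide | contradiction

/-- A standard-form product is at least as long as its staircase. -/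
lemma le_diag_Cspec {L : ℕ} [NeZero L] {k j : ℕ} (hk : 1 ≤ k) (hkL : 2 * k ≤ L)
    (hj : 1 ≤ j) (u1 : Site L) : k ≤ Diag L (Cspec L k j u1) := by
  by_contra! hlt
  obtain ⟨a, ha⟩ := exists_diagBoundAt (Cspec L k j u1)
  have hfit : DiagBoundAt L (Cspec L k j u1) a (k - 1) := fun u hu => by
    have := ha u hu
    omega
  set a' := (stair L u1 j).1 + (stair L u1 j).2 with ha'
  have h1 : lev a' (stair L u1 j) = 0 := by simp [lev, ha']
  have h2 : lev a' (stair L u1 (j + k - 1)) = k - 1 := by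
    rw [lev_eq_iff (by omega)]
    have h3 := stair_sum u1 hj
    have h4 := stair_sum u1 (show 1 ≤ j + k - 1 by omega)
    rw [Nat.add_sub_assoc hk] at h4 ⊢
    push_cast at h4
    linear_combination h4 - h3
  exact not_diagBoundAt_of_lev (a := a') (by omega) hfit (Cspec_first u1) (Cspec_last u1) (by omega)

/-- For even `k̄` with `4 ≤ k̄ ≤ L/2`, all coefficients of the
standard-form products in a local conserved quantity vanish; consequently
`q_σ = 0` for every Pauli product with `Diag σ = k̄`, i.e. there is no local
conserved quantity with diagonal length `k̄`. -/
theorem no_local_conserved_quantity_even_k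
    (L : ℕ) [NeZero L] (Jx Jy : ℝ) (hJx : Jx ≠ 0) (hJy : Jy ≠ 0)
    (k : ℕ) (heven : k % 2 = 0) (hk : 4 ≤ k) (hkL : 2 * k ≤ L)
    (q : PSpec L → ℂ)
    (hsupp : ∀ σ : PSpec L, q σ ≠ 0 → σ ≠ 0 ∧ Diag L σ ≤ k)
    (hcons : opComm L (Hcompass L Jx Jy) (Qop L q) = 0) :
    (∀ (u1 : Site L) (j : ℕ), 1 ≤ j → q (Cspec L k j u1) = 0) ∧
    (∀ σ : PSpec L, Diag L σ = k → q σ = 0) := by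
  obtain ⟨M, rfl⟩ : ∃ M, k = M + 1 + 1 := ⟨k - 2, by omega⟩
  have h := isConserved_of_opComm_eq_zero hJx hJy (K := M + 1) (by omega) hkL
    (fun σ hσ => (hsupp σ hσ).2) hcons
  have hmax : ∀ σ : PSpec L, Diag L σ = M + 1 + 1 → q σ = 0 := by
    intro σ hσ
    obtain ⟨a, ha⟩ := exists_diagBoundAt σ
    rw [hσ] at ha
    rcases spansLevels_or_diagBoundAt ha with hs | ⟨a', ha'⟩
    · exact h.coeff_eq_zero (by omega) hs
    · have := diag_le_of_diagBoundAt ha'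
      omega
  refine ⟨fun u1 j hj => ?_, hmax⟩
  by_contra hq
  exact hq (hmax _ (le_antisymm (hsupp _ hq).2 (le_diag_Cspec (by omega) hkL hj u1)))
end

section
/- Let Q = Σ_{A∈P_Λ, Diag A ≤ 2} q_A A satisfy [H,Q] = 0 and suppose 2 ≤ L/2. Then there exists a constant η ∈ ℂ such that q_{X_u X_{u+e_x}} = η J_x and q_{Y_u Y_{u+e_y}} = η J_y for all u ∈ Λ, and q_A = 0 for every other Pauli product A with Diag A = 2; combined with the absence of conserved quantities of diagonal length 1, Q is a constant multiple of H (up to a multiple of the identity). -/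
open Complex Matrix

namespace QuantumCompass

/-- The product of two Pauli letters, up to a phase. -/
def letterMul (a b : Fin 4) : Fin 4 := a ^^^ b

lemma letterMul_zero (a : Fin 4) : letterMul a 0 = a := by revert a; decide

lemma letterMul_eq_zero {a b : Fin 4} : letterMul a b = 0 ↔ a = b := by revert a b; decide

lemma zero_letterMul (a : Fin 4) : letterMul 0 a = a := by revert a; decide

lemma letterMul_comm (a b : Fin 4) : letterMul a b = letterMul b a := by revert a b; decide

lemma letterMul_cancel_right (a b : Fin 4) : letterMul (letterMul a b) b = a := by
  revert a b; decide

lemma letterMul_cancel_comm (a b : Fin 4) : letterMul (letterMul a b) a = b := by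
  revert a b; decide

/-- The phase in the product of two Pauli matrices. -/
noncomputable def phase (a b : Fin 4) : ℂ :=
  if a = 0 ∨ b = 0 ∨ a = b then 1
  else if (a = 1 ∧ b = 2) ∨ (a = 2 ∧ b = 3) ∨ (a = 3 ∧ b = 1) then Complex.I
  else -Complex.I

lemma phase_zero_left (a : Fin 4) : phase 0 a = 1 := by simp [phase]

lemma phase_zero_right (a : Fin 4) : phase a 0 = 1 := by simp [phase]

lemma phase_self (a : Fin 4) : phase a a = 1 := by simp [phase]

lemma pauli_mul (a b : Fin 4) : pauli a * pauli b = phase a b • pauli (letterMul a b) := by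
  fin_cases a <;> fin_cases b <;> ext i j <;> fin_cases i <;> fin_cases j <;>
    simp [pauli, phase, letterMul, Matrix.mul_apply, Fin.sum_univ_two, Matrix.one_apply]

lemma trace_pauli (a : Fin 4) : (pauli a).trace = if a = 0 then 2 else 0 := by
  fin_cases a <;> simp [pauli, Matrix.trace, Fin.sum_univ_two]

/-- The commutator of a pair of letters `a ⊗ b` with `w ⊗ w`, as a multiple of their product. -/
noncomputable def commPhase (w a b : Fin 4) : ℂ :=
  phase a w * phase b w - phase w a * phase w b

lemma commPhase_ne_zero_iff (w a b : Fin 4) :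
    commPhase w a b ≠ 0 ↔ (w ≠ 0 ∧ ((a ≠ 0 ∧ a ≠ w) ∧ (b = 0 ∨ b = w) ∨
      (a = 0 ∨ a = w) ∧ (b ≠ 0 ∧ b ≠ w))) := by
  have h : Complex.I + Complex.I ≠ 0 := by
    rw [← two_mul]; exact mul_ne_zero two_ne_zero Complex.I_ne_zero
  have h' : -Complex.I - Complex.I ≠ 0 := by
    rw [← neg_add', neg_ne_zero]; exact h
  fin_cases w <;> fin_cases a <;> fin_cases b <;> simp [commPhase, phase, h, h']

/-- The Pauli letter on the bonds of a given direction. -/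
def letter (i : Bool) : Fin 4 := if i then 2 else 1

lemma letter_ne_zero (i : Bool) : letter i ≠ 0 := by revert i; decide

lemma letter_inj {i j : Bool} : letter i = letter j ↔ i = j := by revert i j; decide

lemma exists_letter_ne (a : Fin 4) : ∃ j, a ≠ letter j := by revert a; decide

variable {L : ℕ}

/-- Sitewise product of Pauli specifications, up to a phase. -/
def specMul (σ τ : PSpec L) : PSpec L := fun x => letterMul (σ x) (τ x)

lemma specMul_eq_zero {σ τ : PSpec L} : specMul σ τ = 0 ↔ σ = τ := by
  simp [specMul, funext_iff, letterMul_eq_zero]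

/-- The unit vector along a bond direction. -/
def dir (L : ℕ) (i : Bool) : Site L := if i then (0, 1) else (1, 0)

/-- The two-site Pauli product on a bond. -/
def bond (b : Bool × Site L) : PSpec L := fun x =>
  if x = b.2 then letter b.1 else if x = b.2 + dir L b.1 then letter b.1 else 0

/-- The index of the antidiagonal of a site. -/
def antidiag (x : Site L) : ZMod L := x.1 + x.2

lemma antidiag_add_dir (x : Site L) (i : Bool) : antidiag (x + dir L i) = antidiag x + 1 := by
  cases i <;> simp [antidiag, dir] <;> ring

lemma natCast_ne_zero (hL : 4 ≤ L) {n : ℕ} (h0 : 0 < n) (h : n < 4) : (n : ZMod L) ≠ 0 := by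
  rw [Ne, ZMod.natCast_eq_zero_iff]
  exact fun h' => by have := Nat.le_of_dvd h0 h'; omega

lemma small_ne_zero (hL : 4 ≤ L) :
    (1 : ZMod L) ≠ 0 ∧ (2 : ZMod L) ≠ 0 ∧ (3 : ZMod L) ≠ 0 := by
  have h1 := natCast_ne_zero hL (n := 1) (by norm_num) (by norm_num)
  have h2 := natCast_ne_zero hL (n := 2) (by norm_num) (by norm_num)
  have h3 := natCast_ne_zero hL (n := 3) (by norm_num) (by norm_num)
  push_cast at h1 h2 h3
  exact ⟨h1, h2, h3⟩

lemma dir_inj (hL : 4 ≤ L) {i j : Bool} : dir L i = dir L j ↔ i = j := by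
  have h := (small_ne_zero hL).1
  cases i <;> cases j <;> simp [dir, h, h.symm]

lemma site_ne_add_dir (hL : 4 ≤ L) (u : Site L) (i : Bool) : u ≠ u + dir L i := fun h => by
  have := congrArg antidiag h
  rw [antidiag_add_dir, left_eq_add] at this
  exact (small_ne_zero hL).1 this

section Operators

variable [NeZero L]

lemma pauliOp_mul (σ τ : PSpec L) :
    PauliOp L σ * PauliOp L τ = (∏ x, phase (σ x) (τ x)) • PauliOp L (specMul σ τ) := by
  ext s t
  simp only [Matrix.mul_apply, PauliOp, Matrix.smul_apply, smul_eq_mul, ← Finset.prod_mul_distrib]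
  rw [← Fintype.prod_sum (fun x k => pauli (σ x) (s x) k * pauli (τ x) k (t x))]
  refine Finset.prod_congr rfl fun x _ => ?_
  rw [← Matrix.mul_apply, pauli_mul]
  rfl

lemma trace_pauliOp (σ : PSpec L) :
    (PauliOp L σ).trace = if σ = 0 then 2 ^ Fintype.card (Site L) else 0 := by
  have h : (PauliOp L σ).trace = ∏ x, (pauli (σ x)).trace := by
    simp only [Matrix.trace, Matrix.diag, PauliOp]
    exact (Fintype.prod_sum (fun x k => pauli (σ x) k k)).symm
  rw [h]
  simp only [trace_pauli]
  split_ifs with h0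
  · simp [h0]
  · obtain ⟨x, hx⟩ := Function.ne_iff.mp h0
    exact Finset.prod_eq_zero (Finset.mem_univ x) (if_neg hx)

lemma pauliOp_zero : PauliOp L 0 = 1 := by
  ext s t
  simp only [PauliOp, Pi.zero_apply, Matrix.one_apply, funext_iff]
  have h : pauli 0 = 1 := by simp [pauli]
  simp only [h, Matrix.one_apply]
  split_ifs with hst
  · simp [hst]
  · obtain ⟨x, hx⟩ := not_forall.mp hst
    exact Finset.prod_eq_zero (Finset.mem_univ x) (if_neg hx)

lemma prod_bond (hL : 4 ≤ L) (f : Site L → Fin 4 → ℂ) (hf : ∀ x, f x 0 = 1)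
    (b : Bool × Site L) :
    ∏ x, f x (bond b x) = f b.2 (letter b.1) * f (b.2 + dir L b.1) (letter b.1) := by
  rw [Fintype.prod_eq_mul b.2 (b.2 + dir L b.1) (site_ne_add_dir hL _ _)]
  · simp [bond]
  · rintro x ⟨h1, h2⟩
    simp [bond, h1, h2, hf]

lemma trace_mul_commutator {n : Type*} [Fintype n] (A B C : Matrix n n ℂ) :
    (A * (B * C - C * B)).trace = ((A * B - B * A) * C).trace := by
  rw [mul_sub, sub_mul, Matrix.trace_sub, Matrix.trace_sub, ← mul_assoc, ← mul_assoc,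
    Matrix.trace_mul_cycle A C B]

lemma trace_mul_opComm_bond (hL : 4 ≤ L) (σ τ : PSpec L) (b : Bool × Site L) :
    (PauliOp L τ * opComm L (PauliOp L (bond b)) (PauliOp L σ)).trace =
      if specMul τ (bond b) = σ then
        commPhase (letter b.1) (τ b.2) (τ (b.2 + dir L b.1)) * 2 ^ Fintype.card (Site L)
      else 0 := by
  have hc : specMul (bond b) τ = specMul τ (bond b) :=
    funext fun x => letterMul_comm _ _
  rw [opComm, trace_mul_commutator, pauliOp_mul, pauliOp_mul, hc, ← sub_smul, smul_mul_assoc,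
    Matrix.trace_smul, pauliOp_mul, Matrix.trace_smul, trace_pauliOp,
    prod_bond hL (fun x w => phase (τ x) w) (fun x => phase_zero_right _),
    prod_bond hL (fun x w => phase w (τ x)) (fun x => phase_zero_left _)]
  simp only [specMul_eq_zero]
  split_ifs with hs
  · simp only [hs, phase_self, Finset.prod_const_one, one_mul, commPhase, smul_eq_mul]
  · simp

/-- The coupling constant of the bonds of a given direction. -/
def coupling (Jx Jy : ℝ) (i : Bool) : ℂ := if i then Jy else Jx

lemma hcompass_eq (Jx Jy : ℝ) :
    Hcompass L Jx Jy = -∑ b : Bool × Site L, coupling Jx Jy b.1 • PauliOp L (bond b) := by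
  have hX : ∀ u, sigXX L u = bond (false, u) := fun u => rfl
  have hY : ∀ u, sigYY L u = bond (true, u) := fun u => rfl
  simp only [Hcompass, hX, hY, Fintype.sum_prod_type, Fintype.sum_bool, Finset.sum_add_distrib]
  simp [coupling, add_comm]

/-- The coefficients of `[H, Q]` vanish. -/
def IsConserved (J : Bool → ℂ) (q : PSpec L → ℂ) : Prop :=
  ∀ τ : PSpec L, ∑ b : Bool × Site L,
    J b.1 * commPhase (letter b.1) (τ b.2) (τ (b.2 + dir L b.1)) * q (specMul τ (bond b)) = 0

lemma isConserved_of_opComm_eq_zero (hL : 4 ≤ L) {Jx Jy : ℝ} {q : PSpec L → ℂ}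
    (h : opComm L (Hcompass L Jx Jy) (Qop L q) = 0) : IsConserved (coupling Jx Jy) q := by
  intro τ
  have hexp : opComm L (Hcompass L Jx Jy) (Qop L q) = -∑ b : Bool × Site L, ∑ σ : PSpec L,
      (coupling Jx Jy b.1 * q σ) • opComm L (PauliOp L (bond b)) (PauliOp L σ) := by
    have hl : ∀ A B : Op L, opComm L (-A) B = -opComm L A B := fun A B => by
      simp only [opComm]; noncomm_ring
    rw [hcompass_eq, hl, opComm, Qop, Finset.sum_mul_sum, Finset.sum_mul_sum, Finset.sum_comm,
      ← Finset.sum_sub_distrib, Finset.sum_comm]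
    simp only [← Finset.sum_sub_distrib, opComm, smul_mul_smul_comm, smul_sub, mul_comm (q _)]
  have htr : (PauliOp L τ * opComm L (Hcompass L Jx Jy) (Qop L q)).trace = 0 := by simp [h]
  simp only [hexp, mul_neg, Matrix.trace_neg, Finset.mul_sum, Matrix.trace_sum, mul_smul_comm,
    Matrix.trace_smul, trace_mul_opComm_bond hL, neg_eq_zero, smul_eq_mul, mul_ite, mul_zero,
    Finset.sum_ite_eq, Finset.mem_univ, if_true, ← mul_assoc, ← Finset.sum_mul] at htr
  refine Eq.trans (Finset.sum_congr rfl fun b _ => ?_)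
    ((mul_eq_zero.mp htr).resolve_right (pow_ne_zero _ two_ne_zero))
  ring

end Operators

section Combinatorics

lemma bond_left (i : Bool) (v : Site L) : bond (i, v) v = letter i := by simp [bond]

lemma bond_right (i : Bool) (v : Site L) : bond (i, v) (v + dir L i) = letter i := by simp [bond]

lemma bond_cases (i : Bool) (v x : Site L) :
    (bond (i, v) x = letter i ∧ (x = v ∨ x = v + dir L i)) ∨
      (bond (i, v) x = 0 ∧ x ≠ v ∧ x ≠ v + dir L i) := by
  unfold bond; grind

lemma bond_of_ne {i : Bool} {v x : Site L} (h : x ≠ v) (h' : x ≠ v + dir L i) :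
    bond (i, v) x = 0 := by simp [bond, h, h']

lemma bond_ne_zero (b : Bool × Site L) : bond b ≠ 0 := fun h => by
  have := congrFun h b.2
  simp [bond, letter_ne_zero] at this

lemma bond_injective (hL : 4 ≤ L) : Function.Injective (bond (L := L)) := by
  rintro ⟨i, v⟩ ⟨j, u⟩ h
  obtain ⟨h1, h2, h3⟩ := small_ne_zero hL
  have a1 := congrFun h v
  have a2 := congrFun h (v + dir L i)
  rw [bond_left] at a1
  rw [bond_right] at a2
  have hi := letter_ne_zero i
  have b1 := bond_cases j u v
  have b2 := bond_cases j u (v + dir L i)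
  have hij : i = j := letter_inj.mp (by grind)
  have c1 := antidiag_add_dir u j
  have c2 := antidiag_add_dir v i
  subst hij
  grind

/-- The support meets at most two antidiagonals, which are adjacent. -/
def IsNarrow (σ : PSpec L) : Prop :=
  ∃ c, ∀ x, σ x ≠ 0 → antidiag x = c ∨ antidiag x = c + 1

lemma IsNarrow.antidiag_near {σ : PSpec L} (h : IsNarrow σ) {x y : Site L} (hx : σ x ≠ 0)
    (hy : σ y ≠ 0) : antidiag x = antidiag y ∨ antidiag x = antidiag y + 1 ∨
      antidiag y = antidiag x + 1 := by
  obtain ⟨c, hc⟩ := h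
  have := hc x hx
  have := hc y hy
  grind

lemma IsNarrow.antidiag_eq (hL : 4 ≤ L) {σ : PSpec L} (h : IsNarrow σ) {x y z : Site L}
    (hx : σ x ≠ 0) (hy : σ y ≠ 0) (hxy : antidiag y = antidiag x + 1) (hz : σ z ≠ 0) :
    antidiag z = antidiag x ∨ antidiag z = antidiag x + 1 := by
  obtain ⟨c, hc⟩ := h
  obtain ⟨h1, h2, h3⟩ := small_ne_zero hL
  have := hc x hx
  have := hc y hy
  have := hc z hz
  grind

variable {J : Bool → ℂ} {q : PSpec L → ℂ}

/-- If `σ` is extended upwards at a top site `u`, the only other narrow Pauli products from which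
the result can be reached are those obtained by truncating the bottom site. -/
lemma eq_or_eq_of_isNarrow (hL : 4 ≤ L) {σ : PSpec L} (hσ : IsNarrow σ) {p u : Site L}
    (hp : σ p ≠ 0) (hu : σ u ≠ 0) (hpu : antidiag u = antidiag p + 1) {j : Bool}
    (hj : σ u ≠ letter j) {i : Bool} {v : Site L}
    (hρ : IsNarrow (specMul (specMul σ (bond (j, u))) (bond (i, v)))) :
    (i, v) = (j, u) ∨ (v = p ∧ σ p = letter i) := by
  obtain ⟨h1, h2, h3⟩ := small_ne_zero hL
  have hs := fun x (hx : σ x ≠ 0) => hσ.antidiag_eq hL hp hu hpu hx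
  have du := antidiag_add_dir u j
  have dv := antidiag_add_dir v i
  have τu : specMul σ (bond (j, u)) u ≠ 0 := by
    simpa only [specMul, bond_left, Ne, letterMul_eq_zero] using hj
  have σu' : σ (u + dir L j) = 0 := by
    by_contra h
    have := hs _ h
    grind
  have τu' : specMul σ (bond (j, u)) (u + dir L j) = letter j := by
    simp only [specMul, bond_right, σu', zero_letterMul]
  have τp : specMul σ (bond (j, u)) p = σ p := by
    rw [specMul, bond_of_ne (by grind) (by grind), letterMul_zero]
  have τ0 : ∀ x, antidiag x = antidiag p ∨ antidiag x = antidiag p + 1 ∨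
      antidiag x = antidiag p + 2 ∨ specMul σ (bond (j, u)) x = 0 := by
    intro x
    by_contra! hx
    obtain ⟨hx, hx', hx'', hx0⟩ := hx
    apply hx0
    have : σ x = 0 := by
      by_contra h
      have := hs _ h
      grind
    rw [specMul, bond_of_ne (by grind) (by grind), letterMul_zero, this]
  generalize specMul σ (bond (j, u)) = τ at *
  have near := fun x y => hρ.antidiag_near (x := x) (y := y)
  simp only [specMul, Ne, letterMul_eq_zero, ← or_iff_not_imp_left] at near
  have hli := letter_ne_zero i
  have hlj := letter_ne_zero j
  have hinj := letter_inj (i := i) (j := j)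
  have b1 := bond_cases i v p
  have b2 := bond_cases i v u
  have b3 := bond_cases i v (u + dir L j)
  have b4 := bond_left i v
  have b5 := bond_right i v
  have n1 := near p (u + dir L j)
  have n2 := near v (u + dir L j)
  have n3 := near (v + dir L i) u
  have n4 := near v u
  have t1 := τ0 v
  have t2 := τ0 (v + dir L i)
  by_cases hc : τ (u + dir L j) = bond (i, v) (u + dir L j)
  · have hij : i = j := hinj.mp (by grind)
    subst hij
    clear near τ0 hs hinj
    grind (splits := 20)
  · clear near τ0 hs hinj
    grind (splits := 20)

lemma letterMul_eq_right {a b : Fin 4} : letterMul a b = b ↔ a = 0 := by revert a b; decide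

variable [NeZero L]

lemma IsConserved.exists_ne (hq : IsConserved J q) (hJ : ∀ i, J i ≠ 0) {σ : PSpec L} (hσ : q σ ≠ 0)
    {j : Bool} {u : Site L} (hu : σ u ≠ 0) (hj : σ u ≠ letter j) (hu' : σ (u + dir L j) = 0) :
    ∃ i v, (i, v) ≠ (j, u) ∧
      commPhase (letter i) (specMul σ (bond (j, u)) v) (specMul σ (bond (j, u)) (v + dir L i)) ≠ 0 ∧
      q (specMul (specMul σ (bond (j, u))) (bond (i, v))) ≠ 0 := by
  by_contra! h
  have hs := hq (specMul σ (bond (j, u)))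
  rw [Fintype.sum_eq_single (j, u)] at hs
  · have hc : specMul (specMul σ (bond (j, u))) (bond (j, u)) = σ :=
      funext fun x => letterMul_cancel_right _ _
    rw [hc] at hs
    refine mul_ne_zero (mul_ne_zero (hJ _) ?_) hσ hs
    rw [commPhase_ne_zero_iff]
    refine ⟨letter_ne_zero j, Or.inl ⟨⟨?_, ?_⟩, Or.inr ?_⟩⟩
    · simpa only [specMul, bond_left, Ne, letterMul_eq_zero] using hj
    · simpa only [specMul, bond_left, Ne, letterMul_eq_right] using hu
    · simp only [specMul, bond_right, hu', zero_letterMul]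
  · rintro ⟨i, v⟩ hne
    by_cases hc : commPhase (letter i) (specMul σ (bond (j, u)) v)
        (specMul σ (bond (j, u)) (v + dir L i)) = 0
    · simp [hc]
    · rw [h i v hne hc, mul_zero]

lemma exists_truncation (hL : 4 ≤ L) (hq : IsConserved J q) (hJ : ∀ i, J i ≠ 0)
    (hn : ∀ σ, q σ ≠ 0 → IsNarrow σ) {σ : PSpec L} (hσ : q σ ≠ 0) {p u : Site L}
    (hp : σ p ≠ 0) (hu : σ u ≠ 0) (hpu : antidiag u = antidiag p + 1) {j : Bool}
    (hj : σ u ≠ letter j) :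
    ∃ i, σ p = letter i ∧ q (specMul (specMul σ (bond (j, u))) (bond (i, p))) ≠ 0 ∧
      specMul σ (bond (j, u)) (p + dir L i) ≠ 0 ∧
      specMul σ (bond (j, u)) (p + dir L i) ≠ letter i ∧
      ∀ p', antidiag p' = antidiag p → σ p' ≠ 0 → p' = p := by
  obtain ⟨h1, h2, h3⟩ := small_ne_zero hL
  have du := antidiag_add_dir u j
  have hu' : σ (u + dir L j) = 0 := by
    by_contra h
    have := (hn σ hσ).antidiag_eq hL hp hu hpu h
    grind
  obtain ⟨i, v, hne, hc, hρ⟩ := hq.exists_ne hJ hσ hu hj hu'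
  have key := fun {p'} (hp' : σ p' ≠ 0) (h : antidiag u = antidiag p' + 1) =>
    (eq_or_eq_of_isNarrow hL (hn σ hσ) hp' hu h hj (hn _ hρ)).resolve_left hne
  obtain ⟨rfl, hi⟩ := key hp hpu
  have τp : specMul σ (bond (j, u)) v = letter i := by
    rw [specMul, bond_of_ne (by grind) (by grind), letterMul_zero, hi]
  rw [commPhase_ne_zero_iff, τp] at hc
  refine ⟨i, hi, hρ, ?_, ?_, fun p' h h' => (key h' (h ▸ hpu)).1.symm⟩ <;> tauto

lemma exists_unique_ends (hL : 4 ≤ L) (hq : IsConserved J q) (hJ : ∀ i, J i ≠ 0)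
    (hn : ∀ σ, q σ ≠ 0 → IsNarrow σ) {σ : PSpec L} (hσ : q σ ≠ 0) {p u : Site L}
    (hp : σ p ≠ 0) (hu : σ u ≠ 0) (hpu : antidiag u = antidiag p + 1) {j : Bool}
    (hj : σ u ≠ letter j) :
    ∃ i, σ p = letter i ∧ u = p + dir L i ∧ letterMul (σ u) (letter j) ≠ letter i ∧
      q (specMul (specMul σ (bond (j, u))) (bond (i, p))) ≠ 0 ∧
      (∀ p', antidiag p' = antidiag p → σ p' ≠ 0 → p' = p) ∧
      ∀ u', antidiag u' = antidiag u → σ u' ≠ 0 → u' = u := by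
  obtain ⟨h1, h2, h3⟩ := small_ne_zero hL
  obtain ⟨i, hi, hρ, hi0, hi1, hp'⟩ := exists_truncation hL hq hJ hn hσ hp hu hpu hj
  have du := antidiag_add_dir u j
  have dp := antidiag_add_dir p i
  have hu' : σ (u + dir L j) = 0 := by
    by_contra h
    have := (hn σ hσ).antidiag_eq hL hp hu hpu h
    grind
  have τu : specMul σ (bond (j, u)) u ≠ 0 := by
    simpa only [specMul, bond_left, Ne, letterMul_eq_zero] using hj
  have hne : ∀ x, antidiag x = antidiag u → specMul σ (bond (j, u)) x ≠ 0 →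
      specMul (specMul σ (bond (j, u))) (bond (i, p)) x ≠ 0 := by
    intro x hx hx0
    rw [specMul, Ne, letterMul_eq_zero]
    rcases bond_cases i p x with ⟨h, rfl | rfl⟩ | ⟨h, -⟩
    · grind
    · rwa [h]
    · rwa [h]
  have htop : specMul (specMul σ (bond (j, u))) (bond (i, p)) (u + dir L j) = letter j := by
    rw [specMul, specMul, bond_right, hu', zero_letterMul,
      bond_of_ne (by grind) (by grind), letterMul_zero]
  obtain ⟨k, hk⟩ := exists_letter_ne (letter j)
  obtain ⟨-, -, -, -, -, huniq⟩ := exists_truncation hL hq hJ hn hρ (hne u rfl τu)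
    (htop ▸ letter_ne_zero j) du (htop ▸ hk)
  have hu'' : ∀ u', antidiag u' = antidiag u → specMul σ (bond (j, u)) u' ≠ 0 → u' = u :=
    fun u' h h' => huniq u' h (hne u' h h')
  have hup : p + dir L i = u := hu'' _ (by grind) hi0
  refine ⟨i, hi, hup.symm, ?_, hρ, hp', fun u' h h' => ?_⟩
  · rwa [hup, specMul, bond_left] at hi1
  · by_contra hne'
    refine hne' (hu'' u' h ?_)
    rwa [specMul, bond_of_ne hne' (by grind), letterMul_zero]

lemma letter_trichotomy (i : Bool) (a : Fin 4) : a = 0 ∨ a = letter i ∨ a = letter (!i) ∨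
    (a ≠ letter (!i) ∧ letterMul a (letter (!i)) = letter i) := by revert i a; decide

/-- A Pauli product occupying two antidiagonals can only occur if it is a bond. -/
lemma eq_bond_of_antidiag (hL : 4 ≤ L) (hq : IsConserved J q) (hJ : ∀ i, J i ≠ 0)
    (hn : ∀ σ, q σ ≠ 0 → IsNarrow σ) {σ : PSpec L} (hσ : q σ ≠ 0) {p u : Site L}
    (hp : σ p ≠ 0) (hu : σ u ≠ 0) (hpu : antidiag u = antidiag p + 1) :
    ∃ i, u = p + dir L i ∧ σ = bond (i, p) := by
  obtain ⟨j, hj⟩ := exists_letter_ne (σ u)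
  obtain ⟨i, hi, rfl, hji, hρ, hp', hu'⟩ := exists_unique_ends hL hq hJ hn hσ hp hu hpu hj
  obtain ⟨h1, h2, h3⟩ := small_ne_zero hL
  have d := antidiag_add_dir (p + dir L i) i
  rcases letter_trichotomy i (σ (p + dir L i)) with h | h | h | ⟨h, h'⟩
  · exact absurd h hu
  · refine ⟨i, rfl, funext fun x => ?_⟩
    rcases bond_cases i p x with ⟨hb, rfl | rfl⟩ | ⟨hb, hx, hx'⟩
    · rw [hb, hi]
    · rw [hb, h]
    · rw [hb]
      by_contra h0
      rcases (hn σ hσ).antidiag_eq hL hp hu hpu h0 with e | e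
      · exact hx (hp' x e h0)
      · exact hx' (hu' x (e.trans hpu.symm) h0)
  · have hji' : j = i := by
      rw [h, Ne, letter_inj] at hj
      revert hj; cases i <;> cases j <;> simp
    subst hji'
    have hx : specMul (specMul σ (bond (j, p + dir L j))) (bond (j, p)) (p + dir L j) =
        letter (!j) := by
      simp only [specMul, bond_left, bond_right, letterMul_cancel_right, h]
    have hy : specMul (specMul σ (bond (j, p + dir L j))) (bond (j, p)) (p + dir L j + dir L j) =
        letter j := by
      have h0 : σ (p + dir L j + dir L j) = 0 := by
        by_contra h0
        have := (hn σ hσ).antidiag_eq hL hp hu hpu h0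
        grind
      rw [specMul, specMul, h0, bond_right, zero_letterMul, bond_of_ne (by grind) (by grind),
        letterMul_zero]
    obtain ⟨k, hk⟩ := exists_letter_ne (letter j)
    obtain ⟨l, hl, hl', -⟩ := exists_unique_ends hL hq hJ hn hρ (hx ▸ letter_ne_zero _)
      (hy ▸ letter_ne_zero _) d (hy ▸ hk)
    rw [hx, letter_inj] at hl
    rw [add_right_inj, dir_inj hL] at hl'
    simp [hl'] at hl
  · obtain ⟨k, hk, hk', hk'', -⟩ := exists_unique_ends hL hq hJ hn hσ hp hu hpu h
    rw [hi, letter_inj] at hk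
    exact absurd (hk ▸ h') hk''

/-- A conserved quantity living on single antidiagonals is trivial. -/
lemma eq_zero_of_flat (hL : 4 ≤ L) (hq : IsConserved J q) (hJ : ∀ i, J i ≠ 0)
    (hf : ∀ σ, q σ ≠ 0 → ∀ x y, σ x ≠ 0 → σ y ≠ 0 → antidiag x = antidiag y)
    {σ : PSpec L} (h0 : σ ≠ 0) : q σ = 0 := by
  by_contra hσ
  obtain ⟨u, hu : σ u ≠ 0⟩ := Function.ne_iff.mp h0
  obtain ⟨j, hj⟩ := exists_letter_ne (σ u)
  obtain ⟨h1, h2, h3⟩ := small_ne_zero hL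
  have du := antidiag_add_dir u j
  have hs : ∀ x, σ x = 0 ∨ antidiag x = antidiag u := fun x =>
    or_iff_not_imp_left.mpr fun h => hf σ hσ x u h hu
  have hu' : σ (u + dir L j) = 0 :=
    (hs _).resolve_right fun h => h1 (by rwa [du, add_eq_left] at h)
  obtain ⟨i, v, hne, hc, hρ⟩ := hq.exists_ne hJ hσ hu hj hu'
  have hρ' := hf _ hρ
  have dv := antidiag_add_dir v i
  have τu : specMul σ (bond (j, u)) u ≠ 0 := by
    simpa only [specMul, bond_left, Ne, letterMul_eq_zero] using hj
  have τu' : specMul σ (bond (j, u)) (u + dir L j) = letter j := by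
    simp only [specMul, bond_right, hu', zero_letterMul]
  have τ0 : ∀ x, antidiag x = antidiag u ∨ x = u + dir L j ∨ specMul σ (bond (j, u)) x = 0 := by
    intro x
    by_contra! hx
    obtain ⟨hx, hx', hx0⟩ := hx
    refine hx0 ?_
    rw [specMul, bond_of_ne (fun h => hx (congrArg antidiag h)) hx', letterMul_zero]
    exact (hs x).resolve_right hx
  rw [commPhase_ne_zero_iff] at hc
  generalize specMul σ (bond (j, u)) = τ at *
  simp only [specMul, Ne, letterMul_eq_zero, ← or_iff_not_imp_left] at hρ'
  have hlj := letter_ne_zero j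
  have ne1 : ∀ a : ZMod L, a + 1 ≠ a := fun a h => h1 (add_eq_left.mp h)
  have ne2 : ∀ a : ZMod L, a + 1 + 1 ≠ a := fun a h => h2 (by linear_combination h)
  have hτu : τ u = bond (i, v) u := by
    by_contra hτu
    have hj' : τ (u + dir L j) = bond (i, v) (u + dir L j) :=
      ((hρ' u (u + dir L j)).resolve_left hτu).resolve_right
        fun h => ne1 _ (du.symm.trans h.symm)
    rw [τu'] at hj'
    rcases bond_cases i v (u + dir L j) with ⟨hb, hx⟩ | ⟨hb, -⟩
    · obtain rfl : j = i := letter_inj.mp (hj'.trans hb)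
      rcases hx with rfl | hx
      · have hu2 : antidiag (u + dir L j + dir L j) ≠ antidiag u := by
          rw [dv, du]; exact ne2 _
        rcases hρ' u (u + dir L j + dir L j) with h | h | h
        · exact hτu h
        · rw [bond_right] at h
          rcases τ0 (u + dir L j + dir L j) with h' | h' | h'
          · exact hu2 h'
          · exact site_ne_add_dir hL _ j h'.symm
          · exact hlj (h.symm.trans h')
        · exact hu2 h.symm
      · rw [add_left_inj] at hx
        exact hne (by rw [hx])
    · exact hlj (hj'.trans hb)
  rcases bond_cases i v u with ⟨hb, rfl | rfl⟩ | ⟨hb, -⟩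
  · rcases τ0 (u + dir L i) with h | h | h
    · rw [dv] at h; exact ne1 _ h
    · rw [add_right_inj, dir_inj hL] at h
      exact hne (by rw [h])
    · have := hτu.trans hb
      tauto
  · rcases τ0 v with h | h | h
    · rw [dv] at h; exact ne1 _ h.symm
    · have := congrArg antidiag h
      rw [du, dv] at this
      exact ne2 _ this.symm
    · have := hτu.trans hb
      tauto
  · exact τu (hτu.trans hb)

lemma IsConserved.add_eq_zero (hq : IsConserved J q) (τ : PSpec L) {b b' : Bool × Site L}
    (hb : b ≠ b')
    (h : ∀ i v, commPhase (letter i) (τ v) (τ (v + dir L i)) ≠ 0 →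
      q (specMul τ (bond (i, v))) ≠ 0 → (i, v) = b ∨ (i, v) = b') :
    J b.1 * commPhase (letter b.1) (τ b.2) (τ (b.2 + dir L b.1)) * q (specMul τ (bond b)) +
      J b'.1 * commPhase (letter b'.1) (τ b'.2) (τ (b'.2 + dir L b'.1)) *
        q (specMul τ (bond b')) = 0 := by
  rw [← hq τ, eq_comm]
  refine Fintype.sum_eq_add b b' hb ?_
  rintro ⟨i, v⟩ ⟨h1, h2⟩
  by_contra h0
  simp only [mul_eq_zero, not_or] at h0
  rcases h i v h0.1.2 h0.2 with h' | h'
  · exact h1 h'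
  · exact h2 h'

lemma commPhase_letter_left (i : Bool) :
    commPhase (letter i) (letter i) 3 = commPhase (letter i) 3 (letter i) := by
  simp [commPhase, phase_self]

lemma commPhase_letter_not (i : Bool) :
    commPhase (letter (!i)) 3 (letter (!i)) = -commPhase (letter i) 3 (letter i) := by
  cases i <;> simp [commPhase, phase, letter]
  ring

lemma commPhase_letter_ne_zero (i : Bool) : commPhase (letter i) 3 (letter i) ≠ 0 := by
  rw [commPhase_ne_zero_iff]; revert i; decide

lemma three_ne_letter (i : Bool) : (3 : Fin 4) ≠ letter i := by revert i; decide

lemma letterMul_letter_not (i : Bool) : letterMul (letter i) (letter (!i)) = 3 := by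
  revert i; decide

lemma bond_shift_eq (hL : 4 ≤ L) (hq : IsConserved J q) (hn : ∀ σ, q σ ≠ 0 → IsNarrow σ)
    (i : Bool) (v : Site L) :
    J (!i) * q (bond (i, v)) = J i * q (bond (!i, v + dir L i)) := by
  obtain ⟨h1, h2, h3⟩ := small_ne_zero hL
  set u := v + dir L i with hu
  have du : antidiag u = antidiag v + 1 := antidiag_add_dir v i
  have du' := antidiag_add_dir u (!i)
  have su : bond (i, v) u = letter i := bond_right i v
  have sv := bond_left i v
  have hli := letter_ne_zero i
  have hlj : letter i ≠ letter (!i) := by rw [Ne, letter_inj]; simp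
  have hnar : IsNarrow (bond (i, v)) := ⟨antidiag v, fun x hx => by
    rcases bond_cases i v x with ⟨-, rfl | rfl⟩ | ⟨h, -⟩
    · exact Or.inl rfl
    · exact Or.inr (antidiag_add_dir v i)
    · exact absurd h hx⟩
  have τv : specMul (bond (i, v)) (bond (!i, u)) v = letter i := by
    rw [specMul, sv, bond_of_ne (by grind) (by grind), letterMul_zero]
  have τu : specMul (bond (i, v)) (bond (!i, u)) u = 3 := by
    rw [specMul, su, bond_left, letterMul_letter_not]
  have τu' : specMul (bond (i, v)) (bond (!i, u)) (u + dir L (!i)) = letter (!i) := by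
    rw [specMul, bond_right, bond_of_ne (by grind) (by grind), zero_letterMul]
  have key := hq.add_eq_zero (specMul (bond (i, v)) (bond (!i, u))) (b := (!i, u)) (b' := (i, v))
    (by simp) (fun k w _ hk => by
      rcases eq_or_eq_of_isNarrow hL hnar (sv ▸ hli) (su ▸ hli) du (su ▸ hlj) (hn _ hk) with
        h | ⟨rfl, h⟩
      · exact Or.inl h
      · rw [sv, letter_inj] at h
        exact Or.inr (by rw [h]))
  have c1 : specMul (specMul (bond (i, v)) (bond (!i, u))) (bond (!i, u)) = bond (i, v) :=
    funext fun x => letterMul_cancel_right _ _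
  have c2 : specMul (specMul (bond (i, v)) (bond (!i, u))) (bond (i, v)) = bond (!i, u) :=
    funext fun x => letterMul_cancel_comm _ _
  rw [c1, c2] at key
  simp only [← hu, τv, τu, τu', commPhase_letter_not, commPhase_letter_left] at key
  refine mul_left_cancel₀ (commPhase_letter_ne_zero i) ?_
  linear_combination -key

lemma bond_swap_eq (hL : 4 ≤ L) (hq : IsConserved J q) (hJ : ∀ i, J i ≠ 0)
    (hn : ∀ σ, q σ ≠ 0 → IsNarrow σ) (i : Bool) (v : Site L) :
    J (!i) * q (bond (i, v)) = J i * q (bond (!i, v)) := by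
  obtain ⟨h1, h2, h3⟩ := small_ne_zero hL
  have di := antidiag_add_dir v i
  have dj := antidiag_add_dir v (!i)
  have hij : v + dir L i ≠ v + dir L (!i) := by
    rw [Ne, add_right_inj, dir_inj hL]; simp
  have τv : specMul (bond (i, v)) (bond (!i, v)) v = 3 := by
    rw [specMul, bond_left, bond_left, letterMul_letter_not]
  have τi : specMul (bond (i, v)) (bond (!i, v)) (v + dir L i) = letter i := by
    rw [specMul, bond_right, bond_of_ne (site_ne_add_dir hL v i).symm hij, letterMul_zero]
  have τj : specMul (bond (i, v)) (bond (!i, v)) (v + dir L (!i)) = letter (!i) := by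
    rw [specMul, bond_right, bond_of_ne (site_ne_add_dir hL v (!i)).symm hij.symm,
      zero_letterMul]
  have τ0 : ∀ x, x = v ∨ x = v + dir L i ∨ x = v + dir L (!i) ∨
      specMul (bond (i, v)) (bond (!i, v)) x = 0 := by
    intro x
    by_contra! h
    refine h.2.2.2 ?_
    rw [specMul, bond_of_ne h.1 h.2.1, bond_of_ne h.1 h.2.2.1, letterMul_zero]
  have c1 : specMul (specMul (bond (i, v)) (bond (!i, v))) (bond (!i, v)) = bond (i, v) :=
    funext fun x => letterMul_cancel_right _ _
  have c2 : specMul (specMul (bond (i, v)) (bond (!i, v))) (bond (i, v)) = bond (!i, v) :=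
    funext fun x => letterMul_cancel_comm _ _
  have key := hq.add_eq_zero (specMul (bond (i, v)) (bond (!i, v))) (b := (!i, v)) (b' := (i, v))
    (by simp) ?_
  · rw [c1, c2] at key
    simp only [τv, τi, τj, commPhase_letter_not] at key
    refine mul_left_cancel₀ (commPhase_letter_ne_zero i) ?_
    linear_combination -key
  clear c1 c2
  intro k w _ hk
  have near := fun x y => (hn _ hk).antidiag_near (x := x) (y := y)
  have hbond := fun x y hx hy hxy => eq_bond_of_antidiag hL hq hJ hn hk (p := x) (u := y) hx hy hxy
  generalize specMul (bond (i, v)) (bond (!i, v)) = τ at *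
  have hv : specMul τ (bond (k, w)) v ≠ 0 := by
    rw [specMul, Ne, letterMul_eq_zero, τv]
    rcases bond_cases k w v with ⟨h, -⟩ | ⟨h, -⟩ <;> rw [h]
    · exact three_ne_letter k
    · decide
  -- if an arm of the corner is removed, the bond used is that arm
  have arm : ∀ l, τ (v + dir L l) = letter l → specMul τ (bond (k, w)) (v + dir L l) = 0 →
      (k, w) = (l, v) := by
    intro l hτ h
    rw [specMul, letterMul_eq_zero, hτ] at h
    have dl := antidiag_add_dir v l
    have dw := antidiag_add_dir w k
    rcases bond_cases k w (v + dir L l) with ⟨h', hw⟩ | ⟨h', -⟩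
    · obtain rfl : l = k := letter_inj.mp (h.trans h')
      rcases hw with hw | hw
      · exfalso
        have hx : specMul τ (bond (l, w)) (w + dir L l) ≠ 0 := by
          have t := τ0 (w + dir L l)
          have h0 : τ (w + dir L l) = 0 := by grind
          rw [specMul, h0, zero_letterMul, bond_right]
          exact letter_ne_zero l
        have := near _ _ hv hx
        grind
      · rw [add_left_inj] at hw
        rw [hw]
    · exact absurd (h.trans h') (letter_ne_zero l)
  by_cases hi : specMul τ (bond (k, w)) (v + dir L i) = 0
  · exact Or.inr (arm i τi hi)
  by_cases hj : specMul τ (bond (k, w)) (v + dir L (!i)) = 0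
  · exact Or.inl (arm (!i) τj hj)
  exfalso
  obtain ⟨l, hl, hb⟩ := hbond v _ hv hi di
  rw [hb] at hj
  rcases bond_cases l v (v + dir L (!i)) with ⟨-, h | h⟩ | ⟨h, -⟩
  · exact site_ne_add_dir hL v (!i) h.symm
  · exact hij (hl.trans h.symm)
  · exact hj h

/-- The coefficients of the bonds are proportional to the coupling constants. -/
lemma exists_bond_eq (hL : 4 ≤ L) (hq : IsConserved J q) (hJ : ∀ i, J i ≠ 0)
    (hn : ∀ σ, q σ ≠ 0 → IsNarrow σ) : ∃ η : ℂ, ∀ b, q (bond b) = η * J b.1 := by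
  set g : Bool → Site L → ℂ := fun i v => q (bond (i, v)) / J i with hg
  have e1 : ∀ i v, g i v = g (!i) (v + dir L i) := fun i v => by
    have h := bond_shift_eq hL hq hn i v
    refine (div_eq_div_iff (hJ _) (hJ _)).mpr ?_
    linear_combination h
  have e2 : ∀ i v, g i v = g (!i) v := fun i v => by
    have h := bond_swap_eq hL hq hJ hn i v
    refine (div_eq_div_iff (hJ _) (hJ _)).mpr ?_
    linear_combination h
  have e3 : ∀ i v, g false (v + dir L i) = g false v := by
    rintro (_ | _) v
    · rw [e2, ← e1]
    · exact (e1 true v).symm.trans (e2 true v)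
  have e4 : ∀ (i : Bool) (n : ℕ) v, g false (v + n • dir L i) = g false v := by
    intro i n v
    induction n with
    | zero => simp
    | succ n ih => rw [succ_nsmul, ← add_assoc, e3, ih]
  have e5 : ∀ v, g false v = g false 0 := by
    intro v
    have : v = 0 + v.1.val • dir L false + v.2.val • dir L true := by
      ext <;> simp [dir]
    rw [this, e4, e4]
  refine ⟨g false 0, ?_⟩
  rintro ⟨i, v⟩
  have : g i v = g false 0 := by
    cases i
    · exact e5 v
    · rw [e2, Bool.not_true, e5]
  rw [← this, hg, div_mul_cancel₀ _ (hJ i)]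

end Combinatorics

lemma isNarrow_of_diag_le_two [NeZero L] {σ : PSpec L} (h : Diag L σ ≤ 2) : IsNarrow σ := by
  have hne : {k | ∃ a : ZMod L, DiagBoundAt L σ a k}.Nonempty :=
    ⟨L, 0, fun u _ => ZMod.val_lt _⟩
  obtain ⟨a, ha⟩ := Nat.sInf_mem hne
  refine ⟨a, fun x hx => ?_⟩
  have hlt : (antidiag x - a).val < 2 := (ha x hx).trans_le h
  have hc := ZMod.natCast_zmod_val (antidiag x - a)
  interval_cases (antidiag x - a).val
  · exact Or.inl (sub_eq_zero.mp (by simpa using hc.symm))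
  · exact Or.inr (by rw [← sub_eq_iff_eq_add', ← hc, Nat.cast_one])

/-- The coefficients of `-H`. -/
def hamCoeff [NeZero L] (Jx Jy : ℝ) (σ : PSpec L) : ℂ :=
  ∑ b : Bool × Site L, if bond b = σ then coupling Jx Jy b.1 else 0

lemma qop_hamCoeff [NeZero L] (Jx Jy : ℝ) :
    Qop L (hamCoeff Jx Jy) = -Hcompass L Jx Jy := by
  simp only [hcompass_eq, neg_neg, Qop, hamCoeff, Finset.sum_smul]
  rw [Finset.sum_comm]
  simp [ite_smul]

lemma hamCoeff_bond [NeZero L] (hL : 4 ≤ L) (Jx Jy : ℝ) (b : Bool × Site L) :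
    hamCoeff Jx Jy (bond b) = coupling Jx Jy b.1 := by
  simp [hamCoeff, (bond_injective hL).eq_iff]

lemma hamCoeff_of_ne [NeZero L] (Jx Jy : ℝ) {σ : PSpec L} (h : ∀ b, bond b ≠ σ) :
    hamCoeff Jx Jy σ = 0 := by
  simp [hamCoeff, h]

lemma eq_hamCoeff_add [NeZero L] (hL : 4 ≤ L) {Jx Jy : ℝ} (hJ : ∀ i, coupling Jx Jy i ≠ 0)
    {q : PSpec L → ℂ} (hn : ∀ σ, q σ ≠ 0 → IsNarrow σ)
    (hcons : opComm L (Hcompass L Jx Jy) (Qop L q) = 0) :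
    ∃ η : ℂ, q = η • hamCoeff Jx Jy + Pi.single 0 (q 0) := by
  have hq := isConserved_of_opComm_eq_zero hL hcons
  obtain ⟨η, hη⟩ := exists_bond_eq hL hq hJ hn
  refine ⟨η, ?_⟩
  set r : PSpec L → ℂ := q - η • hamCoeff Jx Jy with hr
  have hQ : Qop L r = Qop L q + η • Hcompass L Jx Jy := by
    rw [← neg_neg (Hcompass L Jx Jy), ← qop_hamCoeff, smul_neg, ← sub_eq_add_neg]
    simp [Qop, hr, sub_smul, Finset.sum_sub_distrib, Finset.smul_sum, mul_smul]
  have hrc : IsConserved (coupling Jx Jy) r := by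
    refine isConserved_of_opComm_eq_zero hL ?_
    rw [hQ, ← hcons]
    simp only [opComm, mul_add, add_mul, mul_smul_comm, smul_mul_assoc]
    abel
  have hrb : ∀ b, r (bond b) = 0 := fun b => by
    simp [hr, hη, hamCoeff_bond hL]
  have hrq : ∀ {σ}, (∀ b, bond b ≠ σ) → r σ = q σ := fun h => by
    simp [hr, hamCoeff_of_ne Jx Jy h]
  have hflat : ∀ σ, r σ ≠ 0 → ∀ x y, σ x ≠ 0 → σ y ≠ 0 → antidiag x = antidiag y := by
    intro σ hσ x y hx hy
    have hb : ∀ b, bond b ≠ σ := fun b h => hσ (h ▸ hrb b)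
    rw [hrq hb] at hσ
    rcases (hn σ hσ).antidiag_near hx hy with h | h | h
    · exact h
    · obtain ⟨i, -, h⟩ := eq_bond_of_antidiag hL hq hJ hn hσ hy hx h
      exact absurd h.symm (hb _)
    · obtain ⟨i, -, h⟩ := eq_bond_of_antidiag hL hq hJ hn hσ hx hy h
      exact absurd h.symm (hb _)
  funext σ
  by_cases h0 : σ = 0
  · subst h0
    simp [hamCoeff_of_ne Jx Jy bond_ne_zero]
  · have := eq_zero_of_flat hL hrc hJ hflat h0
    simpa [hr, h0, sub_eq_zero] using this

end QuantumCompass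

/-- For `k̄ = 2` (with `2 ≤ L/2`) any local conserved quantity
has `q_{X_u X_{u+eₓ}} = η Jx` and `q_{Y_u Y_{u+e_y}} = η Jy` for a common
constant `η`, all other coefficients of products with diagonal length `2`
vanish, and `Q` is a constant multiple of `H` up to a multiple of the identity. -/
theorem diag_two_conserved_quantity_is_multiple_of_H
    (L : ℕ) [NeZero L] (hL : 4 ≤ L) (Jx Jy : ℝ) (hJx : Jx ≠ 0) (hJy : Jy ≠ 0)
    (q : PSpec L → ℂ)
    (hsupp : ∀ σ : PSpec L, q σ ≠ 0 → Diag L σ ≤ 2)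
    (hcons : opComm L (Hcompass L Jx Jy) (Qop L q) = 0) :
    ∃ η : ℂ,
      (∀ u : Site L, q (sigXX L u) = η * (Jx : ℂ) ∧ q (sigYY L u) = η * (Jy : ℂ)) ∧
      (∀ σ : PSpec L, Diag L σ = 2 →
        (∀ u : Site L, σ ≠ sigXX L u ∧ σ ≠ sigYY L u) → q σ = 0) ∧
      Qop L q = (-η) • Hcompass L Jx Jy + q 0 • (1 : Op L) := by
  have hJ : ∀ i, QuantumCompass.coupling Jx Jy i ≠ 0 := by
    rintro (_ | _) <;> simpa [QuantumCompass.coupling]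
  obtain ⟨η, hη⟩ := QuantumCompass.eq_hamCoeff_add hL hJ
    (fun σ h => QuantumCompass.isNarrow_of_diag_le_two (hsupp σ h)) hcons
  have hbond : ∀ b, q (QuantumCompass.bond b) = η * QuantumCompass.coupling Jx Jy b.1 := by
    intro b
    rw [hη]
    simp [QuantumCompass.hamCoeff_bond hL, QuantumCompass.bond_ne_zero]
  refine ⟨η, fun u => ⟨hbond (false, u), hbond (true, u)⟩, fun σ hσ hne => ?_, ?_⟩
  · have hb : ∀ b, QuantumCompass.bond b ≠ σ := by
      rintro ⟨_ | _, u⟩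
      · exact (hne u).1.symm
      · exact (hne u).2.symm
    have h0 : σ ≠ 0 := by
      rintro rfl
      have h : Diag L 0 ≤ 0 := Nat.sInf_le ⟨0, fun u hu => absurd rfl hu⟩
      omega
    rw [hη]
    simp [QuantumCompass.hamCoeff_of_ne Jx Jy hb, h0]
  · rw [neg_smul, ← smul_neg, ← QuantumCompass.qop_hamCoeff, ← QuantumCompass.pauliOp_zero]
    conv_lhs => rw [hη]
    simp [Qop, add_smul, Finset.sum_add_distrib, Finset.smul_sum, mul_smul, Pi.single_apply]
end
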